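/- arXiv:1902.06987 — 3 statements merged into one kernel-verified Lean document; each statement's English description precedes it below -/
import Mathlib

section
/- Let $n\ge2$ and $C_0>0$. Then there is a constant $C=C(n,C_0)$ with the following property. Let $t\in\mathbb{R}$, $r\ge0$, let $(c_\nu)_{\nu\in\mathbb{Z}}$ be a square-summable sequence of complex numbers, and let $(a_\nu)_{\nu\in\mathbb{Z}}$ and nonnegative $(R_\nu)_{\nu\in\mathbb{Z}}$ satisfy, for every $\nu$, $|a_\nu|\le\frac{|c_\nu|}{(1+|t-\frac{\nu}{4}|)^{\frac{n-1}{2}}(1+|r-|t-\frac{\nu}{4}||)^{\frac12}}\Big[\frac{1}{(1+|r-|t-\frac{\nu}{4}||)^{\frac12}}+R_\nu\Big]$, together with $\sum_\nu\frac{R_\nu^2}{1+|r-|t-\frac{\nu}{4}||}\le C_0$. Then $\big|\sum_{\nu\in\mathbb{Z}}a_\nu\big|\le C\Big(\sum_{\nu\in\mathbb{Z}}\frac{|c_\nu|^2}{(1+|t-\frac{\nu}{4}|)^{n-1}}\Big)^{1/2}$. -/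
/-!
STATEMENT 7: The Cauchy–Schwarz summation step.
For `n ≥ 2` and `C₀ > 0` there is a constant `C = C(n, C₀)` such that: for all `t ∈ ℝ`,
`r ≥ 0`, any square-summable `(c_ν)_{ν ∈ ℤ}`, and any `(a_ν)`, `(R_ν ≥ 0)` satisfying the
pointwise bound
`|a_ν| ≤ |c_ν| / ((1+|t-ν/4|)^{(n-1)/2} (1+|r-|t-ν/4| |)^{1/2}) ⬝ (1/(1+|r-|t-ν/4| |)^{1/2} + R_ν)`
together with `∑_ν R_ν² / (1+|r-|t-ν/4| |) ≤ C₀`, one has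
`|∑_ν a_ν| ≤ C (∑_ν |c_ν|²/(1+|t-ν/4|)^{n-1})^{1/2}`.
-/

/-- The sum of `(1 + |s - ν / 4|)⁻²` over the integers is bounded uniformly in `s`. -/
theorem exists_forall_tsum_one_div_one_add_abs_sub_sq_le :
    ∃ K : ℝ, 0 ≤ K ∧ ∀ s : ℝ,
      Summable (fun ν : ℤ => 1 / (1 + |s - (ν : ℝ) / 4|) ^ 2) ∧
      ∑' ν : ℤ, 1 / (1 + |s - (ν : ℝ) / 4|) ^ 2 ≤ K := by
  have hg : Summable (fun k : ℤ => 16 * (1 / |(k : ℝ) + 1 / 2| ^ (2 : ℝ))) :=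
    ((Real.summable_one_div_int_add_rpow (1 / 2) 2).2 (by norm_num)).mul_left 16
  refine ⟨∑' k : ℤ, 16 * (1 / |(k : ℝ) + 1 / 2| ^ (2 : ℝ)),
    tsum_nonneg fun k => by positivity, fun s => ?_⟩
  let e : ℤ ≃ ℤ := Equiv.addRight (-⌊4 * s⌋)
  have hbound : ∀ ν : ℤ, 1 / (1 + |s - (ν : ℝ) / 4|) ^ 2 ≤
      16 * (1 / |((e ν : ℤ) : ℝ) + 1 / 2| ^ (2 : ℝ)) := by
    intro ν
    have hcast : ((e ν : ℤ) : ℝ) = ν - ⌊4 * s⌋ := by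
      simp [e, sub_eq_add_neg]
    have hle : |((e ν : ℤ) : ℝ) + 1 / 2| ≤ 4 * (1 + |s - (ν : ℝ) / 4|) := by
      have h₁ := Int.floor_le (4 * s)
      have h₂ := Int.lt_floor_add_one (4 * s)
      have h₃ := le_abs_self (s - (ν : ℝ) / 4)
      have h₄ := neg_abs_le (s - (ν : ℝ) / 4)
      rw [hcast, abs_le]
      constructor <;> linarith
    have hpos : 0 < |((e ν : ℤ) : ℝ) + 1 / 2| := by
      rw [abs_pos]
      intro h
      have h' : ((2 * e ν + 1 : ℤ) : ℝ) = 0 := by push_cast; linarith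
      have h'' : 2 * e ν + 1 = 0 := by exact_mod_cast h'
      omega
    rw [Real.rpow_two, mul_one_div, div_le_div_iff₀ (by positivity) (by positivity)]
    nlinarith [pow_le_pow_left₀ hpos.le hle 2]
  have hge : Summable (fun ν : ℤ => 16 * (1 / |((e ν : ℤ) : ℝ) + 1 / 2| ^ (2 : ℝ))) :=
    e.summable_iff.2 hg
  have hs := Summable.of_nonneg_of_le (fun ν => by positivity) hbound hge
  refine ⟨hs, (hs.tsum_le_tsum hbound hge).trans_eq ?_⟩
  exact e.tsum_eq (fun k : ℤ => 16 * (1 / |(k : ℝ) + 1 / 2| ^ (2 : ℝ)))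

/-- The sum of `(1 + |r - |t - ν / 4||)⁻²` over the integers is bounded uniformly in `t`, `r`. -/
theorem exists_forall_tsum_one_div_one_add_abs_sub_abs_sq_le :
    ∃ K : ℝ, 0 ≤ K ∧ ∀ t r : ℝ,
      Summable (fun ν : ℤ => 1 / (1 + |r - abs (t - (ν : ℝ) / 4)|) ^ 2) ∧
      ∑' ν : ℤ, 1 / (1 + |r - abs (t - (ν : ℝ) / 4)|) ^ 2 ≤ K := by
  obtain ⟨K, hK, h⟩ := exists_forall_tsum_one_div_one_add_abs_sub_sq_le
  refine ⟨K + K, by positivity, fun t r => ?_⟩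
  obtain ⟨hs₁, hl₁⟩ := h (t - r)
  obtain ⟨hs₂, hl₂⟩ := h (t + r)
  have hbound : ∀ ν : ℤ, 1 / (1 + |r - abs (t - (ν : ℝ) / 4)|) ^ 2 ≤
      1 / (1 + |t - r - (ν : ℝ) / 4|) ^ 2 + 1 / (1 + |t + r - (ν : ℝ) / 4|) ^ 2 := by
    intro ν
    rcases abs_choice (t - (ν : ℝ) / 4) with hx | hx
    · have : |r - abs (t - (ν : ℝ) / 4)| = |t - r - (ν : ℝ) / 4| := by
        rw [hx, abs_sub_comm, sub_right_comm]
      rw [this]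
      exact le_add_of_nonneg_right (by positivity)
    · have : |r - abs (t - (ν : ℝ) / 4)| = |t + r - (ν : ℝ) / 4| := by
        rw [hx]; exact congrArg abs (by ring)
      rw [this]
      exact le_add_of_nonneg_left (by positivity)
  have hs := Summable.of_nonneg_of_le (fun ν => by positivity) hbound (hs₁.add hs₂)
  refine ⟨hs, (hs.tsum_le_tsum hbound (hs₁.add hs₂)).trans ?_⟩
  rw [hs₁.tsum_add hs₂]
  exact add_le_add hl₁ hl₂

/-- Cauchy–Schwarz for a series dominated termwise by a product of square-summable sequences. -/
theorem norm_tsum_le_sqrt_mul_sqrt_of_norm_le_mul {ι E : Type*} [NormedAddCommGroup E]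
    {a : ι → E} {p q : ι → ℝ} (hp : ∀ i, 0 ≤ p i) (hq : ∀ i, 0 ≤ q i)
    (ha : ∀ i, ‖a i‖ ≤ p i * q i)
    (hps : Summable fun i => p i ^ 2) (hqs : Summable fun i => q i ^ 2) :
    ‖∑' i, a i‖ ≤ √(∑' i, p i ^ 2) * √(∑' i, q i ^ 2) := by
  have hCS := Real.summable_and_inner_le_Lp_mul_Lq_tsum_of_nonneg
    Real.HolderConjugate.two_two hp hq
    (by simpa only [Real.rpow_two] using hps) (by simpa only [Real.rpow_two] using hqs)
  simp only [Real.rpow_two, ← Real.sqrt_eq_rpow] at hCS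
  exact (tsum_of_norm_bounded hCS.1.hasSum ha).trans hCS.2

theorem randomization_cauchy_schwarz_summation_step
    (n : ℕ) (hn : 2 ≤ n) (C₀ : ℝ) (hC₀ : 0 < C₀) :
    ∃ C : ℝ, 0 < C ∧
      ∀ (t r : ℝ), 0 ≤ r →
      ∀ (c a : ℤ → ℂ) (R : ℤ → ℝ),
        Summable (fun ν : ℤ => ‖c ν‖ ^ 2) →
        (∀ ν : ℤ, 0 ≤ R ν) →
        (∀ ν : ℤ, ‖a ν‖ ≤
          ‖c ν‖ / ((1 + |t - (ν : ℝ) / 4|) ^ (((n : ℝ) - 1) / 2)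
              * (1 + |r - abs (t - (ν : ℝ) / 4)|) ^ ((1 : ℝ) / 2))
            * (1 / (1 + |r - abs (t - (ν : ℝ) / 4)|) ^ ((1 : ℝ) / 2) + R ν)) →
        Summable (fun ν : ℤ => R ν ^ 2 / (1 + |r - abs (t - (ν : ℝ) / 4)|)) →
        (∑' ν : ℤ, R ν ^ 2 / (1 + |r - abs (t - (ν : ℝ) / 4)|)) ≤ C₀ →
        ‖∑' ν : ℤ, a ν‖ ≤
          C * Real.sqrt (∑' ν : ℤ, ‖c ν‖ ^ 2 / (1 + |t - (ν : ℝ) / 4|) ^ ((n : ℝ) - 1)) := by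
  obtain ⟨K, hK, hsum⟩ := exists_forall_tsum_one_div_one_add_abs_sub_abs_sq_le
  refine ⟨√(2 * (K + C₀)), Real.sqrt_pos.2 (by positivity), ?_⟩
  intro t r _ c a R hc hR ha hRs hRC
  obtain ⟨hs, hl⟩ := hsum t r
  set u : ℤ → ℝ := fun ν => 1 + |r - abs (t - (ν : ℝ) / 4)| with hu
  set A : ℤ → ℝ := fun ν => 1 + |t - (ν : ℝ) / 4| with hA
  have hu0 : ∀ ν, 0 < u ν := fun ν => by positivity
  have hA1 : ∀ ν, 1 ≤ A ν := fun ν => le_add_of_nonneg_right (abs_nonneg _)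
  have hA0 : ∀ ν, 0 < A ν := fun ν => one_pos.trans_le (hA1 ν)
  have hn1 : (0 : ℝ) ≤ (n : ℝ) - 1 := by
    have : (2 : ℝ) ≤ n := by exact_mod_cast hn
    linarith
  let p : ℤ → ℝ := fun ν => ‖c ν‖ / A ν ^ (((n : ℝ) - 1) / 2)
  let q : ℤ → ℝ := fun ν => 1 / √(u ν) * (1 / √(u ν) + R ν)
  have hp : ∀ ν, 0 ≤ p ν := fun ν =>
    div_nonneg (norm_nonneg _) (Real.rpow_nonneg (hA0 ν).le _)
  have hq : ∀ ν, 0 ≤ q ν := fun ν =>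
    mul_nonneg (by positivity) (add_nonneg (by positivity) (hR ν))
  have hpq : ∀ ν, ‖a ν‖ ≤ p ν * q ν := by
    intro ν
    refine (ha ν).trans_eq ?_
    simp only [p, q, hu, hA, Real.sqrt_eq_rpow]
    rw [← mul_assoc, div_mul_div_comm, mul_one]
  have hp2 : ∀ ν, p ν ^ 2 = ‖c ν‖ ^ 2 / A ν ^ ((n : ℝ) - 1) := by
    intro ν
    simp only [p]
    rw [div_pow, ← Real.rpow_mul_natCast (hA0 ν).le]
    norm_num
  have hps : Summable fun ν => p ν ^ 2 := by
    refine Summable.of_nonneg_of_le (fun ν => sq_nonneg _) (fun ν => ?_) hc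
    rw [hp2]
    exact div_le_self (sq_nonneg _) (Real.one_le_rpow (hA1 ν) hn1)
  have hq2 : ∀ ν, q ν ^ 2 ≤ 2 * (1 / u ν ^ 2 + R ν ^ 2 / u ν) := by
    intro ν
    have hsq : (1 / √(u ν)) ^ 2 = 1 / u ν := by
      rw [div_pow, one_pow, Real.sq_sqrt (hu0 ν).le]
    calc q ν ^ 2 = 1 / u ν * (1 / √(u ν) + R ν) ^ 2 := by rw [mul_pow, hsq]
      _ ≤ 1 / u ν * (2 * ((1 / √(u ν)) ^ 2 + R ν ^ 2)) :=
        mul_le_mul_of_nonneg_left add_sq_le (one_div_pos.2 (hu0 ν)).le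
      _ = 2 * (1 / u ν ^ 2 + R ν ^ 2 / u ν) := by rw [hsq]; generalize u ν = v; ring
  have hbs := (hs.add hRs).mul_left 2
  have hqs : Summable fun ν => q ν ^ 2 :=
    Summable.of_nonneg_of_le (fun ν => sq_nonneg _) hq2 hbs
  have hqC : ∑' ν, q ν ^ 2 ≤ 2 * (K + C₀) := by
    refine (hqs.tsum_le_tsum hq2 hbs).trans ?_
    rw [tsum_mul_left, hs.tsum_add hRs]
    exact mul_le_mul_of_nonneg_left (add_le_add hl hRC) zero_le_two
  refine (norm_tsum_le_sqrt_mul_sqrt_of_norm_le_mul hp hq hpq hps hqs).trans ?_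
  rw [mul_comm, tsum_congr hp2]
  exact mul_le_mul_of_nonneg_right (Real.sqrt_le_sqrt hqC) (Real.sqrt_nonneg _)
end

section
/- Let $n\ge4$ and let $u$ be a free wave on $\mathbb{R}^{n+1}$ ($\Box u=0$) whose data $u[0]$ are Fourier supported in the annulus $\{|\xi|\sim1\}$. Let $0<\mu\lesssim1$ and let $\mathcal{C}$ be a uniformly finitely overlapping cover of the annulus by cubes $c$ of diameter $\mu$, with smooth Fourier localizers $P_c$. Then $\big(\sum_{c\in\mathcal{C}}\|P_cu\|^2_{L_t^2L_x^\infty(\mathbb{R}^{n+1})}\big)^{1/2}\lesssim\mu^{\frac{n-2}{2}}\|u[0]\|_{L^2_x}$. -/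
/-!
STATEMENT 14: Klainerman–Tataru-type `L²_t L^∞_x` square-function bound.
Let `n ≥ 4` and let `u` be a free wave on `ℝ^{n+1}` whose data are Fourier supported in the
annulus `{|ξ| ∼ 1}`.  For a uniformly finitely overlapping cover `𝒞` of the annulus by cubes
of diameter `μ ∈ (0,1]`, with smooth Fourier localizers `P_c`, one has
`(∑_{c ∈ 𝒞} ‖P_c u‖²_{L²_t L^∞_x})^{1/2} ≲ μ^{(n-2)/2} ‖u[0]‖_{L²_x}`.

The free wave with data `(f₀, f₁)` is `u(t) = cos(t√{-Δ}) f₀ + (sin(t√{-Δ})/√{-Δ}) f₁`,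
written on the Fourier side, and `‖u[0]‖_{L²} = ‖f₀‖_{L²} + ‖f₁‖_{L²}` (the `L² × Ḣ^{-1}`-type
data norm at unit frequency).  The implicit constant depends on `n` and the overlap constant
`A` of the cover.
-/

open MeasureTheory FourierTransform Metric
open scoped ENNReal RealInnerProductSpace

noncomputable section

abbrev Esp (n : ℕ) := EuclideanSpace ℝ (Fin n)

/-- mixed space-time norm `L^p_t L^q_x` -/
noncomputable def mixedNorm (n : ℕ) (p q : ℝ≥0∞) (u : ℝ → Esp n → ℂ) : ℝ≥0∞ :=
  eLpNorm (fun t => (eLpNorm (u t) q volume).toReal) p volume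

/-- The smooth frequency localization `P u` (symbol `χ`) of the free wave with data
`(f₀, f₁)`, written via the Fourier representation of the wave propagator. -/
noncomputable def wavePiece (n : ℕ) (χ : Esp n → ℝ) (f0 f1 : Esp n → ℂ)
    (t : ℝ) (x : Esp n) : ℂ :=
  ∫ ξ : Esp n, (χ ξ : ℂ) * Complex.exp (2 * Real.pi * Complex.I * (⟪x, ξ⟫ : ℝ)) *
    ((Real.cos (2 * Real.pi * t * ‖ξ‖) : ℂ) * 𝓕 f0 ξ +
      ((Real.sin (2 * Real.pi * t * ‖ξ‖) / (2 * Real.pi * ‖ξ‖)) : ℝ) * 𝓕 f1 ξ)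

theorem ae_eq_fourierInv_fourier {n : ℕ} {f : Esp n → ℂ} (hf : Integrable f)
    (h : Integrable (𝓕 f)) : f =ᵐ[volume] 𝓕⁻ (𝓕 f) := by
  have hcont : Continuous (𝓕⁻ (𝓕 f)) := by
    rw [Real.fourierInv_eq_fourier_comp_neg]
    exact VectorFourier.fourierIntegral_continuous Real.continuous_fourierChar
      (L := innerₗ (Esp n)) continuous_inner h.comp_neg
  refine ae_eq_of_integral_contDiff_smul_eq hf.locallyIntegrable hcont.locallyIntegrable ?_
  intro g hg hgs
  have hgs' : HasCompactSupport (fun x => (g x : ℂ)) :=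
    hgs.comp_left (g := fun r : ℝ => (r : ℂ)) (by simp)
  let G : SchwartzMap (Esp n) ℂ :=
    hgs'.toSchwartzMap (Complex.ofRealCLM.contDiff.comp hg)
  have hG : ∀ x, G x = (g x : ℂ) := fun x => rfl
  let φ : SchwartzMap (Esp n) ℂ := 𝓕⁻ G
  have hφ : 𝓕 (φ : Esp n → ℂ) = G := by
    rw [← SchwartzMap.fourier_coe, FourierTransform.fourier_fourierInv_eq]
  have hφ' : (φ : Esp n → ℂ) = 𝓕⁻ (G : Esp n → ℂ) := SchwartzMap.fourierInv_coe G
  have h1 : ∫ x, (G x) • f x = ∫ x, φ x • 𝓕 f x := by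
    rw [← hφ]
    simpa using! VectorFourier.integral_fourierIntegral_smul_eq_flip (L := innerₗ (Esp n))
      Real.continuous_fourierChar continuous_inner φ.integrable hf
  have h2 : ∫ x, 𝓕⁻ (G : Esp n → ℂ) x • 𝓕 f x = ∫ x, G x • 𝓕⁻ (𝓕 f) x := by
    have hc : Continuous fun p : Esp n × Esp n => (-innerₗ (Esp n)) p.1 p.2 :=
      (continuous_inner (𝕜 := ℝ) (E := Esp n)).neg
    simpa [VectorFourier.fourierIntegral, Real.fourierInv_eq, real_inner_comm] using!
      VectorFourier.integral_fourierIntegral_smul_eq_flip (L := -innerₗ (Esp n))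
        Real.continuous_fourierChar hc G.integrable h
  rw [hφ', h2] at h1
  simpa [hG] using h1

theorem memLp_two_of_integrable_of_bound {n : ℕ} {f : Esp n → ℂ} (hf : Integrable f) (C : ℝ)
    (hC : ∀ᵐ x, ‖f x‖ ≤ C) : MemLp f 2 := by
  refine (memLp_two_iff_integrable_sq_norm hf.1).2 ?_
  refine (hf.norm.const_mul C).mono' (hf.1.norm.pow 2) ?_
  filter_upwards [hC] with x hx
  rw [Real.norm_of_nonneg (by positivity), sq]
  exact mul_le_mul_of_nonneg_right hx (norm_nonneg _)

theorem memLp_two_of_integrable_fourier {n : ℕ} {f : Esp n → ℂ} (hf : Integrable f)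
    (h : Integrable (𝓕 f)) : MemLp f 2 := by
  refine memLp_two_of_integrable_of_bound hf (∫ ξ, ‖𝓕 f ξ‖) ?_
  filter_upwards [ae_eq_fourierInv_fourier hf h] with x hx
  rw [hx, Real.fourierInv_eq]
  refine (norm_integral_le_integral_norm _).trans (le_of_eq ?_)
  simp

theorem memLp_two_fourier {n : ℕ} {f : Esp n → ℂ} (h : Integrable (𝓕 f)) : MemLp (𝓕 f) 2 := by
  refine memLp_two_of_integrable_of_bound h (∫ ξ, ‖f ξ‖) (ae_of_all _ fun x => ?_)
  rw [Real.fourier_eq]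
  refine (norm_integral_le_integral_norm _).trans (le_of_eq ?_)
  simp

theorem lintegral_enorm_sq_fourier {n : ℕ} {f : Esp n → ℂ} (hf : Integrable f)
    (h : Integrable (𝓕 f)) : ∫⁻ ξ, ‖𝓕 f ξ‖ₑ ^ 2 = ∫⁻ x, ‖f x‖ₑ ^ 2 := by
  have h2 : MemLp (𝓕 f) 2 := memLp_two_fourier h
  have key : ∫ ξ, inner ℂ (𝓕 f ξ) (𝓕 f ξ) = ∫ x, inner ℂ (f x) (𝓕⁻ (𝓕 f) x) := by
    simpa [VectorFourier.fourierIntegral, Real.fourierInv_eq, real_inner_comm, Real.fourier_eq]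
      using!
      VectorFourier.integral_sesq_fourierIntegral_eq_neg_flip (L := innerₗ (Esp n))
        (innerSL ℂ) Real.continuous_fourierChar continuous_inner hf h
  have hparseval : ∫ ξ, inner ℂ (𝓕 f ξ) (𝓕 f ξ) = ∫ x, inner ℂ (f x) (f x) := by
    rw [key]
    refine integral_congr_ae ?_
    filter_upwards [ae_eq_fourierInv_fourier hf h] with x hx
    rw [← hx]
  simp only [inner_self_eq_norm_sq_to_K] at hparseval
  have hnorm_sq : ∫ ξ, ‖𝓕 f ξ‖ ^ 2 = ∫ x, ‖f x‖ ^ 2 := by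
    simp only [Complex.coe_algebraMap, ← Complex.ofReal_pow] at hparseval
    rwa [integral_complex_ofReal, integral_complex_ofReal, Complex.ofReal_inj] at hparseval
  have e : ∀ g : Esp n → ℂ, MemLp g 2 → ENNReal.ofReal (∫ x, ‖g x‖ ^ 2) = ∫⁻ x, ‖g x‖ₑ ^ 2 := by
    intro g hg
    rw [ofReal_integral_eq_lintegral_ofReal ((memLp_two_iff_integrable_sq_norm hg.1).1 hg)
      (ae_of_all _ fun x => by positivity)]
    simp_rw [← ofReal_norm, ENNReal.ofReal_pow (norm_nonneg _)]
  rw [← e _ h2, ← e _ (memLp_two_of_integrable_fourier hf h), hnorm_sq]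

theorem exists_isometric_splitting {m : ℕ} (e : Esp (m + 1)) (he : ‖e‖ = 1) :
    ∃ Φ : ℝ × Esp m → Esp (m + 1), MeasurePreserving Φ ∧ Function.Surjective Φ ∧
      (∀ p q, ⟪Φ p, Φ q⟫ = p.1 * q.1 + ⟪p.2, q.2⟫) ∧
      ∀ p, ⟪e, Φ p⟫ = p.1 := by
  let W := WithLp 2 (ℝ × Esp m)
  have hrank : Module.finrank ℝ W = Fintype.card (Fin (m + 1)) := by
    have : Module.finrank ℝ W = Module.finrank ℝ (ℝ × Esp m) :=
      (WithLp.linearEquiv 2 ℝ (ℝ × Esp m)).finrank_eq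
    rw [this]; simp [add_comm]
  let w : W := WithLp.toLp 2 (1, 0)
  have hw : ‖w‖ = 1 := by
    rw [← sq_eq_sq₀ (norm_nonneg _) zero_le_one, WithLp.prod_norm_sq_eq_of_L2]
    simp [w]
  have h1 : Orthonormal ℝ (({0} : Set (Fin (m + 1))).domRestrict (fun _ => e)) := by
    refine ⟨fun _ => he, fun i j hij => ?_⟩
    exact absurd (Subsingleton.elim i j) hij
  have h2 : Orthonormal ℝ (({0} : Set (Fin (m + 1))).domRestrict (fun _ => w)) := by
    refine ⟨fun _ => hw, fun i j hij => ?_⟩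
    exact absurd (Subsingleton.elim i j) hij
  obtain ⟨b, hb⟩ := h1.exists_orthonormalBasis_extension_of_card_eq (by simp)
  obtain ⟨b', hb'⟩ := h2.exists_orthonormalBasis_extension_of_card_eq hrank
  let L : W ≃ₗᵢ[ℝ] Esp (m + 1) := b'.equiv b (Equiv.refl _)
  have hL : L w = e := by
    rw [← hb' 0 rfl, ← hb 0 rfl]
    simp [L]
  have hmp : MeasurePreserving (fun p : ℝ × Esp m => L (WithLp.toLp 2 p)) :=
    L.measurePreserving.comp (WithLp.volume_preserving_toLp ℝ (Esp m))
  refine ⟨fun p => L (WithLp.toLp 2 p), hmp, ?_, ?_, ?_⟩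
  · exact L.surjective.comp (MeasurableEquiv.toLp 2 (ℝ × Esp m)).surjective
  · intro p q
    rw [L.inner_map_map, WithLp.prod_inner_apply]
    simp [mul_comm]
  · intro p
    rw [← hL, L.inner_map_map, WithLp.prod_inner_apply]
    simp [w]

/-- Null coordinates `(l, η)` on the light cone, for which `a + √(a² + ‖η‖²) = l`. -/
def nullCoord {m : ℕ} (q : ℝ × Esp m) : ℝ × Esp m := ((q.1 - ‖q.2‖ ^ 2 / q.1) / 2, q.2)

theorem measurable_nullCoord {m : ℕ} : Measurable (nullCoord (m := m)) := by
  unfold nullCoord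
  fun_prop

theorem hasDerivAt_nullCoord {l : ℝ} (hl : 0 < l) (r : ℝ) :
    HasDerivAt (fun l : ℝ => (l - r / l) / 2) ((1 + r / l ^ 2) / 2) l := by
  have := ((hasDerivAt_id l).sub ((hasDerivAt_const l r).div (hasDerivAt_id l) hl.ne')).div_const 2
  refine this.congr_deriv ?_
  simp only [id]
  field_simp
  ring

theorem lintegral_eq_lintegral_nullCoord {r : ℝ} (hr : 0 ≤ r) (F : ℝ → ℝ≥0∞)
    (hF : ∀ a, F a ≠ 0 → 0 < a + √(a ^ 2 + r)) :
    ∫⁻ a, F a =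
      ∫⁻ l in Set.Ioi (0 : ℝ), ENNReal.ofReal ((1 + r / l ^ 2) / 2) * F ((l - r / l) / 2) := by
  have hinj : Set.InjOn (fun l : ℝ => (l - r / l) / 2) (Set.Ioi 0) := by
    have : StrictMonoOn (fun l : ℝ => (l - r / l) / 2) (Set.Ioi 0) := by
      intro x hx y hy hxy
      have : r / y ≤ r / x := div_le_div_of_nonneg_left hr hx hxy.le
      dsimp only
      linarith
    exact this.injOn
  have hsub : Function.support F ⊆ (fun l : ℝ => (l - r / l) / 2) '' (Set.Ioi 0) := by
    intro a ha
    have h0 := hF a ha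
    refine ⟨a + √(a ^ 2 + r), h0, ?_⟩
    have hs : √(a ^ 2 + r) ^ 2 = a ^ 2 + r := Real.sq_sqrt (by positivity)
    field_simp
    nlinarith
  calc ∫⁻ a, F a = ∫⁻ a in (fun l : ℝ => (l - r / l) / 2) '' (Set.Ioi 0), F a :=
        (setLIntegral_eq_of_support_subset hsub).symm
    _ = ∫⁻ l in Set.Ioi (0 : ℝ),
          ENNReal.ofReal |(1 + r / l ^ 2) / 2| * F ((l - r / l) / 2) :=
        lintegral_image_eq_lintegral_abs_deriv_mul measurableSet_Ioi
          (fun x hx => (hasDerivAt_nullCoord hx r).hasDerivWithinAt) hinj F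
    _ = ∫⁻ l in Set.Ioi (0 : ℝ),
          ENNReal.ofReal ((1 + r / l ^ 2) / 2) * F ((l - r / l) / 2) := by
      refine setLIntegral_congr_fun measurableSet_Ioi fun l _ => ?_
      rw [abs_of_nonneg (by positivity)]

theorem restrict_le_map_nullCoord {m : ℕ} {Φ : ℝ × Esp m → Esp (m + 1)}
    (hΦ : MeasurePreserving Φ) {S : Set (Esp (m + 1))}
    (hS : MeasurableSet S) {I : Set ℝ} (hI : MeasurableSet I)
    {W : ℝ × Esp m → ℝ≥0∞} (hW : Measurable W)
    (h : ∀ l > 0, ∀ η, Φ (nullCoord (l, η)) ∈ S →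
      l ∈ I ∧ ENNReal.ofReal ((1 + ‖η‖ ^ 2 / l ^ 2) / 2) ≤ W (l, η))
    (hpos : ∀ a η, Φ (a, η) ∈ S → 0 < a + √(a ^ 2 + ‖η‖ ^ 2)) :
    volume.restrict S ≤ Measure.map (fun q => Φ (nullCoord q))
      (((volume.restrict I).prod volume).withDensity W) := by
  have hm : Measurable fun q : ℝ × Esp m => Φ (nullCoord q) :=
    hΦ.measurable.comp measurable_nullCoord
  refine Measure.le_iff.2 fun A hA => ?_
  have hAS : MeasurableSet (A ∩ S) := hA.inter hS
  rw [Measure.restrict_apply hA, Measure.map_apply hm hA, withDensity_apply _ (hm hA),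
    ← hΦ.measure_preimage hAS.nullMeasurableSet, ← lintegral_indicator_one (hΦ.measurable hAS),
    Measure.volume_eq_prod, lintegral_prod_symm' _
      (measurable_one.indicator (hΦ.measurable hAS)), ← lintegral_indicator (hm hA)]
  have hswap : ∫⁻ q, ((fun q => Φ (nullCoord q)) ⁻¹' A).indicator W q
      ∂((volume.restrict I).prod (volume : Measure (Esp m))) ≥
      ∫⁻ η, ∫⁻ l in I, ((fun q => Φ (nullCoord q)) ⁻¹' A).indicator W (l, η) :=
    (lintegral_prod_symm' _ (hW.indicator (hm hA))).ge
  refine le_trans (lintegral_mono fun η => ?_) hswap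
  refine (lintegral_eq_lintegral_nullCoord (sq_nonneg ‖η‖) _ ?_).le.trans ?_
  · intro a ha
    refine hpos a η ?_
    by_contra hc
    exact ha (by simp [hc])
  · rw [← lintegral_indicator measurableSet_Ioi, ← lintegral_indicator hI]
    refine lintegral_mono fun l => ?_
    by_cases hl : l ∈ Set.Ioi (0 : ℝ)
    · by_cases hA' : Φ (nullCoord (l, η)) ∈ A ∩ S
      · obtain ⟨h1, h2⟩ := h l hl η hA'.2
        have h3 : (l, η) ∈ (fun q => Φ (nullCoord q)) ⁻¹' A := hA'.1
        have h4 : ((l - ‖η‖ ^ 2 / l) / 2, η) ∈ Φ ⁻¹' (A ∩ S) := hA'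
        simp only [Set.indicator_of_mem hl, Set.indicator_of_mem h1, Set.indicator_of_mem h3,
          Set.indicator_of_mem h4]
        simpa using h2
      · have h4 : ((l - ‖η‖ ^ 2 / l) / 2, η) ∉ Φ ⁻¹' (A ∩ S) := hA'
        rw [Set.indicator_of_mem hl, Set.indicator_of_notMem h4, mul_zero]
        exact zero_le
    · simp [Set.indicator_of_notMem hl]

/-- A polynomial bump on `[a, a + h]` vanishing to second order at both endpoints. -/
def bump (a h l : ℝ) : ℝ := ((l - a) * (a + h - l)) ^ 2 / h ^ 4

theorem continuous_bump (a h : ℝ) : Continuous (bump a h) := by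
  unfold bump
  fun_prop

theorem bump_nonneg (a h l : ℝ) : 0 ≤ bump a h l := by
  unfold bump
  positivity

theorem bump_le_one {a h l : ℝ} (hh : 0 < h) (hl : l ∈ Set.Icc a (a + h)) : bump a h l ≤ 1 := by
  obtain ⟨h1, h2⟩ := hl
  unfold bump
  rw [div_le_one (by positivity)]
  have h3 : 0 ≤ (l - a) * (a + h - l) := mul_nonneg (by linarith) (by linarith)
  have h4 : (l - a) * (a + h - l) ≤ h ^ 2 := by nlinarith
  calc ((l - a) * (a + h - l)) ^ 2 ≤ (h ^ 2) ^ 2 := by gcongr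
    _ = h ^ 4 := by ring

theorem norm_exp_neg_mul_le_one {ζ : ℂ} (hζ : 0 ≤ ζ.re) {l : ℝ} (hl : 0 ≤ l) :
    ‖Complex.exp (-ζ * l)‖ ≤ 1 := by
  rw [Complex.norm_exp, Real.exp_le_one_iff]
  simp
  positivity

theorem norm_integral_bump_mul_exp_le {a h : ℝ} (ha : 0 ≤ a) (hh : 0 < h) {ζ : ℂ}
    (hζ : 0 ≤ ζ.re) :
    ‖∫ l in a..(a + h), (bump a h l : ℂ) * Complex.exp (-ζ * l)‖ * (1 + h * ‖ζ‖) ^ 2 ≤ 8 * h := by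
  set J := ∫ l in a..(a + h), (bump a h l : ℂ) * Complex.exp (-ζ * l) with hJ
  let ψ₁ : ℝ → ℝ := fun l => 2 * ((l - a) * (a + h - l)) * (2 * a + h - 2 * l) / h ^ 4
  let ψ₂ : ℝ → ℝ := fun l => 2 * ((2 * a + h - 2 * l) ^ 2 - 2 * ((l - a) * (a + h - l))) / h ^ 4
  have hle : a ≤ a + h := by linarith
  have hJ1 : ‖J‖ ≤ h := by
    have := intervalIntegral.norm_integral_le_of_norm_le_const (a := a) (b := a + h) (C := 1)
      (f := fun l : ℝ => (bump a h l : ℂ) * Complex.exp (-ζ * l)) ?_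
    · simpa [hJ, abs_of_pos hh] using this
    · intro l hl
      rw [Set.uIoc_of_le hle] at hl
      rw [norm_mul, Complex.norm_real, Real.norm_of_nonneg (bump_nonneg _ _ _)]
      exact mul_le_one₀ (bump_le_one hh (Set.Ioc_subset_Icc_self hl)) (norm_nonneg _)
        (norm_exp_neg_mul_le_one hζ (ha.trans hl.1.le))
  have hJ2 : ‖ζ‖ ^ 2 * ‖J‖ ≤ 2 / h := by
    have key : ζ ^ 2 * J = ∫ l in a..(a + h), (ψ₂ l : ℂ) * Complex.exp (-ζ * l) := by
      have hd : ∀ l : ℝ, HasDerivAt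
          (fun l : ℝ => -(ζ * (bump a h l : ℂ) + (ψ₁ l : ℂ)) * Complex.exp (-ζ * l))
          (ζ ^ 2 * ((bump a h l : ℂ) * Complex.exp (-ζ * l))
            - (ψ₂ l : ℂ) * Complex.exp (-ζ * l)) l := by
        intro l
        have d0 : HasDerivAt (bump a h) (ψ₁ l) l := by
          have := ((((hasDerivAt_id l).sub_const a).mul
            ((hasDerivAt_id l).const_sub (a + h))).pow 2).div_const (h ^ 4)
          refine this.congr_deriv ?_
          simp [ψ₁]
          ring
        have d1 : HasDerivAt ψ₁ (ψ₂ l) l := by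
          have := (((((hasDerivAt_id l).sub_const a).mul
            ((hasDerivAt_id l).const_sub (a + h))).const_mul 2).mul
            (((hasDerivAt_id l).const_mul 2).const_sub (2 * a + h))).div_const (h ^ 4)
          refine this.congr_deriv ?_
          simp [ψ₂]
          ring
        have d2 : HasDerivAt (fun l : ℝ => Complex.exp (-ζ * l))
            (Complex.exp (-ζ * l) * (-ζ * 1)) l :=
          ((hasDerivAt_id l).ofReal_comp.const_mul (-ζ)).cexp
        refine (((d0.ofReal_comp.const_mul ζ).add d1.ofReal_comp).neg.mul d2).congr_deriv ?_
        simp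
        ring
      have hc1 : Continuous fun l : ℝ => (bump a h l : ℂ) * Complex.exp (-ζ * l) := by
        have := continuous_bump a h
        fun_prop
      have hc2 : Continuous fun l : ℝ => (ψ₂ l : ℂ) * Complex.exp (-ζ * l) := by
        simp only [ψ₂]
        fun_prop
      have := intervalIntegral.integral_eq_sub_of_hasDerivAt (a := a) (b := a + h)
        (fun l _ => hd l) (((hc1.const_mul (ζ ^ 2)).sub hc2).intervalIntegrable _ _)
      rw [intervalIntegral.integral_sub ((hc1.const_mul (ζ ^ 2)).intervalIntegrable _ _)
        (hc2.intervalIntegrable _ _), intervalIntegral.integral_const_mul] at this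
      have h0 : ζ ^ 2 * J - ∫ l in a..(a + h), (ψ₂ l : ℂ) * Complex.exp (-ζ * l) = 0 := by
        rw [hJ, this]
        simp [bump, ψ₁]
      exact sub_eq_zero.1 h0
    rw [← norm_pow, ← norm_mul, key]
    have := intervalIntegral.norm_integral_le_of_norm_le_const (a := a) (b := a + h)
      (C := 2 / h ^ 2) (f := fun l : ℝ => (ψ₂ l : ℂ) * Complex.exp (-ζ * l)) ?_
    · refine this.trans (le_of_eq ?_)
      rw [add_sub_cancel_left, abs_of_pos hh]
      field_simp
    · intro l hl
      rw [Set.uIoc_of_le hle] at hl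
      have e0 := norm_exp_neg_mul_le_one hζ (ha.trans hl.1.le)
      have e1 : |ψ₂ l| ≤ 2 / h ^ 2 := by
        have : 2 / h ^ 2 = 2 * h ^ 2 / h ^ 4 := by field_simp
        rw [this, abs_div, abs_of_pos (show 0 < h ^ 4 by positivity)]
        gcongr
        obtain ⟨h1, h2⟩ := hl
        have h3 : 0 ≤ (l - a) * (a + h - l) := mul_nonneg (by linarith) (by linarith)
        have h4 : (2 * a + h - 2 * l) ^ 2 = h ^ 2 - 4 * ((l - a) * (a + h - l)) := by ring
        rw [abs_le]
        constructor <;> nlinarith [sq_nonneg (2 * a + h - 2 * l)]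
      rw [norm_mul, Complex.norm_real, Real.norm_eq_abs, ← mul_one (2 / h ^ 2)]
      exact mul_le_mul e1 e0 (norm_nonneg _) (by positivity)
  have h3 : h ^ 2 * (‖ζ‖ ^ 2 * ‖J‖) ≤ 2 * h := by
    calc h ^ 2 * (‖ζ‖ ^ 2 * ‖J‖) ≤ h ^ 2 * (2 / h) := by gcongr
      _ = 2 * h := by field_simp
  nlinarith [mul_nonneg (norm_nonneg J) (sq_nonneg (1 - h * ‖ζ‖))]

theorem integral_gaussian_mul_phase {m : ℕ} {l β : ℝ} (hl : 0 < l) (hβ : 0 < β) (s v : ℝ)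
    (y : Esp m) :
    ∫ η : Esp m, ((l ^ (-(m / 2 : ℝ)) * Real.exp (-(Real.pi * β * ‖η‖ ^ 2 / l)) : ℝ) : ℂ) *
      Complex.exp (2 * Real.pi * Complex.I *
        ((l * v / 2 + s * ‖η‖ ^ 2 / (2 * l) + ⟪y, η⟫ : ℝ) : ℂ)) =
    ((β - s * Complex.I : ℂ)⁻¹) ^ (m / 2 : ℂ) *
      Complex.exp (-(Real.pi * (‖y‖ ^ 2 / (β - s * Complex.I) - v * Complex.I)) * l) := by
  set B : ℂ := β - s * Complex.I with hB
  have hBre : B.re = β := by simp [hB]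
  have hB0 : B ≠ 0 := fun h0 => hβ.ne' (by rw [← hBre, h0, Complex.zero_re])
  have hlC : (l : ℂ) ≠ 0 := by exact_mod_cast hl.ne'
  have hπ : (Real.pi : ℂ) ≠ 0 := by exact_mod_cast Real.pi_ne_zero
  have hb : 0 < (Real.pi * B / l : ℂ).re := by
    have : (Real.pi * B / l : ℂ).re = Real.pi * β / l := by
      rw [Complex.div_ofReal_re, Complex.re_ofReal_mul, hBre]
    rw [this]
    positivity
  have hG := GaussianFourier.integral_cexp_neg_mul_sq_norm_add_of_euclideanSpace hb
    (2 * Real.pi * Complex.I) y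
  have h_int : ∀ η : Esp m,
      ((l ^ (-(m / 2 : ℝ)) * Real.exp (-(Real.pi * β * ‖η‖ ^ 2 / l)) : ℝ) : ℂ) *
        Complex.exp (2 * Real.pi * Complex.I *
          ((l * v / 2 + s * ‖η‖ ^ 2 / (2 * l) + ⟪y, η⟫ : ℝ) : ℂ)) =
      (((l ^ (-(m / 2 : ℝ)) : ℝ) : ℂ) * Complex.exp (Real.pi * Complex.I * l * v)) *
        Complex.exp (-(Real.pi * B / l) * ‖η‖ ^ 2 + 2 * Real.pi * Complex.I * ⟪y, η⟫) := by
    intro η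
    push_cast
    rw [mul_assoc, mul_assoc (_ : ℂ) (Complex.exp _) (Complex.exp _), ← Complex.exp_add,
      ← Complex.exp_add, hB]
    congr 2
    field_simp
    ring
  simp_rw [h_int]
  rw [integral_const_mul, hG, Fintype.card_fin]
  have hpow : (Real.pi / (Real.pi * B / l) : ℂ) ^ (m / 2 : ℂ) =
      ((l ^ (m / 2 : ℝ) : ℝ) : ℂ) * B⁻¹ ^ (m / 2 : ℂ) := by
    have : (Real.pi / (Real.pi * B / l) : ℂ) = l * B⁻¹ := by field_simp
    rw [this, Complex.cpow_def_of_ne_zero (mul_ne_zero hlC (inv_ne_zero hB0)),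
      Complex.log_ofReal_mul hl (inv_ne_zero hB0), add_mul, Complex.exp_add,
      Complex.cpow_def_of_ne_zero (inv_ne_zero hB0), Real.rpow_def_of_pos hl]
    push_cast
    rfl
  rw [hpow]
  have hl1 : ((l ^ (-(m / 2 : ℝ)) : ℝ) : ℂ) * ((l ^ (m / 2 : ℝ) : ℝ) : ℂ) = 1 := by
    rw [← Complex.ofReal_mul, ← Real.rpow_add hl]
    simp
  calc _ = (((l ^ (-(m / 2 : ℝ)) : ℝ) : ℂ) * ((l ^ (m / 2 : ℝ) : ℝ) : ℂ)) * B⁻¹ ^ (m / 2 : ℂ) *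
        (Complex.exp (Real.pi * Complex.I * l * v) *
        Complex.exp ((2 * Real.pi * Complex.I) ^ 2 * ‖y‖ ^ 2 / (4 * (Real.pi * B / l)))) := by ring
    _ = _ := by
      rw [hl1, one_mul, ← Complex.exp_add]
      congr 2
      field_simp
      linear_combination 4 * (‖y‖ : ℂ) ^ 2 * Complex.I_sq

theorem add_abs_le_mul_one_add_norm {β h s v t : ℝ} (r : ℝ) (hβ : 0 < β) (hh : 0 < h)
    (hβh : 1 ≤ β * h) (hst : s + v = 2 * t) :
    β + |t| ≤ 2 * ‖(β - s * Complex.I : ℂ)‖ *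
      (1 + h * ‖(Real.pi * (r ^ 2 / (β - s * Complex.I) - v * Complex.I) : ℂ)‖) := by
  set B : ℂ := β - s * Complex.I with hB
  set ζ : ℂ := r ^ 2 / B - v * Complex.I with hζ
  have hre : B.re = β := by simp [hB]
  have him : B.im = -s := by simp [hB]
  have hB0 : B ≠ 0 := fun h0 => hβ.ne' (by rw [← hre, h0, Complex.zero_re])
  have h1 : β ≤ ‖B‖ := by simpa [hre] using Complex.re_le_norm B
  have h2 : |s| ≤ ‖B‖ := by simpa [him] using Complex.abs_im_le_norm B
  have hN : Complex.normSq B = β ^ 2 + s ^ 2 := by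
    rw [Complex.normSq_apply, hre, him]; ring
  have hζre : ζ.re = r ^ 2 * β / (β ^ 2 + s ^ 2) := by
    rw [← hN, ← hre]
    simp [hζ, Complex.div_re, ← Complex.ofReal_pow]
  have hζim : ζ.im = r ^ 2 * s / (β ^ 2 + s ^ 2) - v := by
    have : s = -B.im := by rw [him]; ring
    rw [← hN, this]
    simp [hζ, Complex.div_im, ← Complex.ofReal_pow]
    ring
  have h3 : β * |v| ≤ (β + |s|) * ‖ζ‖ := by
    have : β * v = -(β * ζ.im) + s * ζ.re := by
      rw [hζre, hζim]; field_simp; ring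
    calc β * |v| = |β * v| := by rw [abs_mul, abs_of_pos hβ]
      _ ≤ |-(β * ζ.im)| + |s * ζ.re| := by rw [this]; exact abs_add_le _ _
      _ = β * |ζ.im| + |s| * |ζ.re| := by rw [abs_neg, abs_mul, abs_mul, abs_of_pos hβ]
      _ ≤ β * ‖ζ‖ + |s| * ‖ζ‖ := by
        gcongr
        · exact Complex.abs_im_le_norm ζ
        · exact Complex.abs_re_le_norm ζ
      _ = _ := by ring
  have h4 : ‖(Real.pi * ζ : ℂ)‖ = Real.pi * ‖ζ‖ := by
    rw [norm_mul, Complex.norm_real, Real.norm_of_nonneg Real.pi_pos.le]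
  have h5 : |v| ≤ 2 * ‖B‖ * (h * ‖ζ‖) := by
    have : β * |v| ≤ β * (2 * ‖B‖ * (h * ‖ζ‖)) := by
      calc β * |v| ≤ (β + |s|) * ‖ζ‖ := h3
        _ ≤ (2 * ‖B‖) * ((β * h) * ‖ζ‖) := by
          gcongr
          · linarith
          · exact le_mul_of_one_le_left (norm_nonneg _) hβh
        _ = _ := by ring
    exact le_of_mul_le_mul_left this hβ
  have h6 : ‖ζ‖ ≤ Real.pi * ‖ζ‖ :=
    le_mul_of_one_le_left (norm_nonneg _) (by linarith [Real.pi_gt_three])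
  have h7 : 2 * |t| ≤ |s| + |v| := by
    have := abs_add_le s v
    rwa [hst, abs_mul, abs_two] at this
  rw [h4]
  have h8 : 2 * ‖B‖ * (h * ‖ζ‖) ≤ 2 * ‖B‖ * (h * (Real.pi * ‖ζ‖)) := by gcongr
  linarith [abs_nonneg t]

theorem norm_cpow_mul_div_sq_le {m : ℕ} (hm : 3 ≤ m) {β T Q : ℝ} {B : ℂ} (hβ : 0 < β)
    (hT : 0 < T) (hB : β ≤ ‖B‖) (hQ : 1 ≤ Q) (h : T ≤ 2 * ‖B‖ * Q) :
    ‖B⁻¹ ^ (m / 2 : ℂ)‖ / Q ^ 2 ≤ 4 * β ^ (-((m - 3) / 2 : ℝ)) * T ^ (-(3 / 2) : ℝ) := by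
  have hP : 0 < ‖B‖ := hβ.trans_le hB
  have hm' : (3 : ℝ) ≤ m := by exact_mod_cast hm
  have e1 : ‖B⁻¹ ^ (m / 2 : ℂ)‖ = ‖B‖ ^ (-((m - 3) / 2 : ℝ)) * ‖B‖ ^ (-(3 / 2) : ℝ) := by
    have : (m / 2 : ℂ) = ((m / 2 : ℝ) : ℂ) := by push_cast; rfl
    rw [this, Complex.norm_cpow_real, norm_inv, Real.inv_rpow hP.le, ← Real.rpow_neg hP.le,
      ← Real.rpow_add hP]
    congr 1
    ring
  have e2 : (Q ^ 2)⁻¹ ≤ Q ^ (-(3 / 2) : ℝ) := by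
    rw [← Real.rpow_natCast, ← Real.rpow_neg (by linarith)]
    exact Real.rpow_le_rpow_of_exponent_le hQ (by norm_num)
  have e3 : ‖B‖ ^ (-((m - 3) / 2 : ℝ)) ≤ β ^ (-((m - 3) / 2 : ℝ)) :=
    Real.rpow_le_rpow_of_nonpos hβ hB (by linarith)
  have e4 : (‖B‖ * Q) ^ (-(3 / 2) : ℝ) ≤ (T / 2) ^ (-(3 / 2) : ℝ) :=
    Real.rpow_le_rpow_of_nonpos (by positivity) (by linarith) (by norm_num)
  have e5 : (T / 2) ^ (-(3 / 2) : ℝ) ≤ 4 * T ^ (-(3 / 2) : ℝ) := by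
    rw [Real.div_rpow hT.le zero_le_two, div_eq_mul_inv, mul_comm, ← Real.rpow_neg zero_le_two]
    gcongr
    calc (2 : ℝ) ^ (-(-(3 / 2)) : ℝ) ≤ 2 ^ (2 : ℝ) :=
          Real.rpow_le_rpow_of_exponent_le one_le_two (by norm_num)
      _ = 4 := by norm_num
  rw [e1, div_eq_mul_inv]
  calc _ ≤ β ^ (-((m - 3) / 2 : ℝ)) * ‖B‖ ^ (-(3 / 2) : ℝ) * Q ^ (-(3 / 2) : ℝ) := by gcongr
    _ = β ^ (-((m - 3) / 2 : ℝ)) * (‖B‖ * Q) ^ (-(3 / 2) : ℝ) := by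
      rw [Real.mul_rpow hP.le (by linarith), mul_assoc]
    _ ≤ β ^ (-((m - 3) / 2 : ℝ)) * (4 * T ^ (-(3 / 2) : ℝ)) := by
      gcongr
      exact e4.trans e5
    _ = _ := by ring

/-- The density, in null coordinates, of a smooth majorant of a frequency cap. -/
def capWeight {m : ℕ} (a h β : ℝ) (q : ℝ × Esp m) : ℝ :=
  bump a h q.1 * (q.1 ^ (-(m / 2 : ℝ)) * Real.exp (-(Real.pi * β * ‖q.2‖ ^ 2 / q.1)))

theorem measurable_capWeight {m : ℕ} (a h β : ℝ) : Measurable (capWeight (m := m) a h β) := by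
  have := (continuous_bump a h).measurable
  unfold capWeight
  fun_prop

theorem capWeight_nonneg {m : ℕ} (a h β : ℝ) {q : ℝ × Esp m} (hq : 0 ≤ q.1) :
    0 ≤ capWeight a h β q :=
  mul_nonneg (bump_nonneg _ _ _) (mul_nonneg (Real.rpow_nonneg hq _) (Real.exp_pos _).le)

theorem ae_restrict_Ioo_prod {m : ℕ} (a b : ℝ) :
    ∀ᵐ q ∂((volume.restrict (Set.Ioo a b)).prod (volume : Measure (Esp m))),
      q.1 ∈ Set.Ioo a b :=
  Measure.quasiMeasurePreserving_fst.ae (ae_restrict_mem measurableSet_Ioo)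

theorem integrable_capWeight {m : ℕ} {a h β : ℝ} (ha : 0 < a) (hh : 0 < h) (hβ : 0 < β) :
    Integrable (capWeight a h β)
      ((volume.restrict (Set.Ioo a (a + h))).prod (volume : Measure (Esp m))) := by
  have h1 : Integrable (fun η : Esp m => Real.exp (-(Real.pi * β / (a + h)) * ‖η‖ ^ 2)) := by
    have hb : 0 < ((Real.pi * β / (a + h) : ℝ) : ℂ).re := by
      rw [Complex.ofReal_re]
      have := Real.pi_pos
      positivity
    have := (GaussianFourier.integrable_cexp_neg_mul_sq_norm_add hb 0 (0 : Esp m)).norm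
    refine this.congr (ae_of_all _ fun η => ?_)
    dsimp only
    rw [Complex.norm_exp, show -((Real.pi * β / (a + h) : ℝ) : ℂ) * ‖η‖ ^ 2 +
      0 * (⟪(0 : Esp m), η⟫ : ℂ) = ((-(Real.pi * β / (a + h)) * ‖η‖ ^ 2 : ℝ) : ℂ) by
        push_cast; ring, Complex.ofReal_re]
  have h2 : Integrable (fun _ : ℝ => a ^ (-(m / 2 : ℝ))) (volume.restrict (Set.Ioo a (a + h))) :=
    integrable_const _
  refine (h2.mul_prod h1).mono' (measurable_capWeight a h β).aestronglyMeasurable ?_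
  filter_upwards [ae_restrict_Ioo_prod a (a + h)] with q hq
  have hq0 : 0 < q.1 := ha.trans hq.1
  rw [Real.norm_of_nonneg (capWeight_nonneg a h β hq0.le), capWeight]
  rw [← one_mul (a ^ _ * _)]
  have e1 := bump_le_one hh (Set.Ioo_subset_Icc_self hq)
  have e2 : q.1 ^ (-(m / 2 : ℝ)) ≤ a ^ (-(m / 2 : ℝ)) :=
    Real.rpow_le_rpow_of_nonpos ha hq.1.le (by simp; positivity)
  have e3 : Real.pi * β / (a + h) * ‖q.2‖ ^ 2 ≤ Real.pi * β * ‖q.2‖ ^ 2 / q.1 := by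
    rw [div_mul_eq_mul_div]
    have := Real.pi_pos
    exact div_le_div_of_nonneg_left (by positivity) hq0 hq.2.le
  have e4 := bump_nonneg a h q.1
  gcongr
  linarith

/-- A majorant of Lebesgue measure on a frequency cap, up to a constant. -/
def capMeasure {m : ℕ} (Φ : ℝ × Esp m → Esp (m + 1)) (a h β : ℝ) : Measure (Esp (m + 1)) :=
  Measure.map (fun q => Φ (nullCoord q))
    (((volume.restrict (Set.Ioo a (a + h))).prod volume).withDensity
      fun q => ENNReal.ofReal (capWeight a h β q))

theorem isFiniteMeasure_capMeasure {m : ℕ} (Φ : ℝ × Esp m → Esp (m + 1)) {a h β : ℝ}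
    (ha : 0 < a) (hh : 0 < h) (hβ : 0 < β) : IsFiniteMeasure (capMeasure Φ a h β) := by
  have := isFiniteMeasure_withDensity_ofReal (integrable_capWeight (m := m) ha hh hβ).2
  unfold capMeasure
  infer_instance

theorem norm_integral_capMeasure_le {m : ℕ} (hm : 3 ≤ m) {Φ : ℝ × Esp m → Esp (m + 1)}
    (hΦ : Measurable Φ) (hsurj : Function.Surjective Φ)
    (hinner : ∀ p q, ⟪Φ p, Φ q⟫ = p.1 * q.1 + ⟪p.2, q.2⟫) {a h β : ℝ} (ha : 0 < a) (hh : 0 < h)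
    (hβ : 0 < β) (hβh : 1 ≤ β * h) (t : ℝ) (x : Esp (m + 1)) :
    ‖∫ ξ, Complex.exp (2 * Real.pi * Complex.I * ((⟪x, ξ⟫ + t * ‖ξ‖ : ℝ) : ℂ))
        ∂(capMeasure Φ a h β)‖ ≤
      32 * h * β ^ (-((m - 3) / 2 : ℝ)) * (β + |t|) ^ (-(3 / 2) : ℝ) := by
  obtain ⟨⟨x₁, y⟩, rfl⟩ := hsurj x
  set s := t - x₁ with hs
  set v := t + x₁ with hv
  set B : ℂ := β - s * Complex.I with hB
  set ζ : ℂ := Real.pi * (‖y‖ ^ 2 / B - v * Complex.I) with hζ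
  set E : Esp (m + 1) → ℂ := fun ξ =>
    Complex.exp (2 * Real.pi * Complex.I * ((⟪Φ (x₁, y), ξ⟫ + t * ‖ξ‖ : ℝ) : ℂ)) with hE
  have hEm : Measurable E := by simp only [hE]; fun_prop
  have hmap : Measurable fun q : ℝ × Esp m => Φ (nullCoord q) := hΦ.comp measurable_nullCoord
  have hEn : ∀ ξ, ‖E ξ‖ = 1 := fun ξ => by
    have : 2 * Real.pi * Complex.I * ((⟪Φ (x₁, y), ξ⟫ + t * ‖ξ‖ : ℝ) : ℂ) =
      ((2 * Real.pi * (⟪Φ (x₁, y), ξ⟫ + t * ‖ξ‖) : ℝ) : ℂ) * Complex.I := by push_cast; ring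
    simp only [hE]
    rw [this, Complex.norm_exp_ofReal_mul_I]
  have hphase : ∀ l > 0, ∀ η : Esp m, ⟪Φ (x₁, y), Φ (nullCoord (l, η))⟫ +
      t * ‖Φ (nullCoord (l, η))‖ = l * v / 2 + s * ‖η‖ ^ 2 / (2 * l) + ⟪y, η⟫ := by
    intro l hl η
    have hnorm : ‖Φ (nullCoord (l, η))‖ = (l + ‖η‖ ^ 2 / l) / 2 := by
      rw [← sq_eq_sq₀ (norm_nonneg _) (by positivity), ← real_inner_self_eq_norm_sq, hinner,
        real_inner_self_eq_norm_sq]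
      simp only [nullCoord]
      field_simp
      ring
    rw [hnorm, hinner]
    simp only [nullCoord, hs, hv]
    field_simp
    ring
  have hF : Integrable (fun q => (capWeight a h β q : ℂ) * E (Φ (nullCoord q)))
      ((volume.restrict (Set.Ioo a (a + h))).prod (volume : Measure (Esp m))) := by
    refine (integrable_capWeight (m := m) ha hh hβ).norm.mono'
      (((measurable_capWeight a h β).complex_ofReal.mul (hEm.comp hmap)).aestronglyMeasurable)
      (ae_of_all _ fun q => ?_)
    rw [norm_mul, hEn, mul_one, Complex.norm_real]
  have hpull : ∫ ξ, E ξ ∂(capMeasure Φ a h β) = ∫ q, (capWeight a h β q : ℂ) * E (Φ (nullCoord q))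
      ∂((volume.restrict (Set.Ioo a (a + h))).prod (volume : Measure (Esp m))) := by
    rw [capMeasure, integral_map hmap.aemeasurable hEm.aestronglyMeasurable,
      integral_withDensity_eq_integral_toReal_smul
        (measurable_capWeight a h β).ennreal_ofReal (ae_of_all _ fun _ => ENNReal.ofReal_lt_top)]
    refine integral_congr_ae ?_
    filter_upwards [ae_restrict_Ioo_prod a (a + h)] with q hq
    rw [ENNReal.toReal_ofReal (capWeight_nonneg a h β (ha.trans hq.1).le), Complex.real_smul]
  have hfubini : ∫ q, (capWeight a h β q : ℂ) * E (Φ (nullCoord q))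
      ∂((volume.restrict (Set.Ioo a (a + h))).prod (volume : Measure (Esp m))) =
      B⁻¹ ^ (m / 2 : ℂ) * ∫ l in a..(a + h), (bump a h l : ℂ) * Complex.exp (-ζ * l) := by
    rw [integral_prod _ hF, intervalIntegral.integral_of_le (by linarith),
      ← integral_Ioc_eq_integral_Ioo, ← integral_const_mul, integral_Ioc_eq_integral_Ioo,
      integral_Ioc_eq_integral_Ioo]
    refine setIntegral_congr_fun measurableSet_Ioo fun l hl => ?_
    have hl0 : 0 < l := ha.trans hl.1
    have : ∀ η : Esp m, (capWeight a h β (l, η) : ℂ) * E (Φ (nullCoord (l, η))) =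
        (bump a h l : ℂ) *
        (((l ^ (-(m / 2 : ℝ)) * Real.exp (-(Real.pi * β * ‖η‖ ^ 2 / l)) : ℝ) : ℂ) *
        Complex.exp (2 * Real.pi * Complex.I *
        ((l * v / 2 + s * ‖η‖ ^ 2 / (2 * l) + ⟪y, η⟫ : ℝ) : ℂ))) := by
      intro η
      simp only [hE, hphase l hl0 η, capWeight]
      push_cast
      ring
    simp_rw [this]
    rw [integral_const_mul, integral_gaussian_mul_phase hl0 hβ]
    ring
  have hBre : B.re = β := by simp [hB]
  have hβB : β ≤ ‖B‖ := by simpa [hBre] using Complex.re_le_norm B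
  have hζre : 0 ≤ ζ.re := by
    have : ζ.re = Real.pi * (‖y‖ ^ 2 * B.re / Complex.normSq B) := by
      simp [hζ, Complex.div_re, ← Complex.ofReal_pow]
    rw [this, hBre]
    have := Complex.normSq_nonneg B
    have := Real.pi_pos
    positivity
  have hQ : 1 ≤ 1 + h * ‖ζ‖ := by
    have := mul_nonneg hh.le (norm_nonneg ζ)
    linarith
  rw [hpull, hfubini, norm_mul]
  have k1 : ‖∫ l in a..(a + h), (bump a h l : ℂ) * Complex.exp (-ζ * l)‖ ≤
      8 * h / (1 + h * ‖ζ‖) ^ 2 := by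
    rw [le_div_iff₀ (by positivity)]
    exact norm_integral_bump_mul_exp_le ha.le hh hζre
  have k2 := norm_cpow_mul_div_sq_le (m := m) hm hβ (T := β + |t|)
    (by positivity) hβB hQ
    (add_abs_le_mul_one_add_norm ‖y‖ hβ hh hβh (by simp only [hs, hv]; ring))
  calc _ ≤ ‖B⁻¹ ^ (m / 2 : ℂ)‖ * (8 * h / (1 + h * ‖ζ‖) ^ 2) := by gcongr
    _ = 8 * h * (‖B⁻¹ ^ (m / 2 : ℂ)‖ / (1 + h * ‖ζ‖) ^ 2) := by ring
    _ ≤ 8 * h * (4 * β ^ (-((m - 3) / 2 : ℝ)) * (β + |t|) ^ (-(3 / 2) : ℝ)) := by gcongr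
    _ = _ := by ring

/-- The phase `e^{2πi(x·ξ + t|ξ|)}` of a half wave. -/
def wavePhase {n : ℕ} (t : ℝ) (x ξ : Esp n) : ℂ :=
  Complex.exp (2 * Real.pi * Complex.I * ((⟪x, ξ⟫ + t * ‖ξ‖ : ℝ) : ℂ))

theorem norm_wavePhase {n : ℕ} (t : ℝ) (x ξ : Esp n) : ‖wavePhase t x ξ‖ = 1 := by
  have : 2 * Real.pi * Complex.I * ((⟪x, ξ⟫ + t * ‖ξ‖ : ℝ) : ℂ) =
      ((2 * Real.pi * (⟪x, ξ⟫ + t * ‖ξ‖) : ℝ) : ℂ) * Complex.I := by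
    push_cast
    ring
  rw [wavePhase, this, Complex.norm_exp_ofReal_mul_I]

theorem continuous_wavePhase {n : ℕ} :
    Continuous fun p : ℝ × Esp n × Esp n => wavePhase p.1 p.2.1 p.2.2 := by
  unfold wavePhase
  fun_prop

theorem integrable_wavePhase {n : ℕ} (ν : Measure (Esp n)) [IsFiniteMeasure ν] (t : ℝ)
    (x : Esp n) : Integrable (wavePhase t x) ν := by
  refine (integrable_const (1 : ℝ)).mono' ?_ (ae_of_all _ fun ξ => (norm_wavePhase t x ξ).le)
  have : Continuous (wavePhase t x) :=
    continuous_wavePhase.comp (by fun_prop : Continuous fun ξ : Esp n => (t, x, ξ))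
  exact this.aestronglyMeasurable

theorem exists_cap_majorant {m : ℕ} (hm : 3 ≤ m) : ∃ K : ℝ, 0 < K ∧
    ∀ (e : Esp (m + 1)) (a h β : ℝ), ‖e‖ = 1 → 1 / 4 ≤ a → 0 < h → a + h ≤ 7 → 1 ≤ β →
      1 ≤ β * h → ∃ ν : Measure (Esp (m + 1)), IsFiniteMeasure ν ∧
        volume.restrict {ξ | ‖ξ‖ + ⟪e, ξ⟫ ∈ Set.Icc (a + h / 20) (a + 19 * h / 20) ∧
          β * (‖ξ‖ ^ 2 - ⟪e, ξ⟫ ^ 2) ≤ 4} ≤ ν ∧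
        ∀ t x, ‖∫ ξ, wavePhase t x ξ ∂ν‖ ≤
          K * h * β ^ (-((m - 3) / 2 : ℝ)) * (β + |t|) ^ (-(3 / 2) : ℝ) := by
  set C : ℝ := 33 * ((400 / 19) ^ 2 * (7 ^ (m / 2 : ℝ) * Real.exp (16 * Real.pi))) with hC
  have hC0 : 0 < C := by positivity
  refine ⟨32 * C, by positivity, fun e a h β he ha hh hah hβ hβh => ?_⟩
  obtain ⟨Φ, hΦ, hsurj, hinner, hsplit⟩ := exists_isometric_splitting e he
  have ha0 : 0 < a := by linarith
  have hβ0 : 0 < β := by linarith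
  have hnorm : ∀ p, ‖Φ p‖ ^ 2 = p.1 ^ 2 + ‖p.2‖ ^ 2 := fun p => by
    rw [← real_inner_self_eq_norm_sq, hinner, real_inner_self_eq_norm_sq, ← sq]
  have hfin := isFiniteMeasure_capMeasure Φ ha0 hh hβ0
  refine ⟨ENNReal.ofReal C • capMeasure Φ a h β, ?_, ?_, fun t x => ?_⟩
  · exact Measure.smul_finite _ ENNReal.ofReal_ne_top
  · have hS : MeasurableSet {ξ : Esp (m + 1) |
        ‖ξ‖ + ⟪e, ξ⟫ ∈ Set.Icc (a + h / 20) (a + 19 * h / 20) ∧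
          β * (‖ξ‖ ^ 2 - ⟪e, ξ⟫ ^ 2) ≤ 4} := by
      refine IsClosed.measurableSet (IsClosed.and ?_ ?_)
      · exact isClosed_Icc.preimage (by fun_prop)
      · exact isClosed_le (by fun_prop) continuous_const
    rw [capMeasure, ← Measure.map_smul, ← withDensity_smul _
      (measurable_capWeight a h β).ennreal_ofReal]
    refine restrict_le_map_nullCoord hΦ hS measurableSet_Ioo
      ((measurable_capWeight a h β).ennreal_ofReal.const_smul _) ?_ ?_
    · rintro l hl η ⟨⟨h1, h2⟩, h3⟩
      have e1 : ‖Φ (nullCoord (l, η))‖ = (l + ‖η‖ ^ 2 / l) / 2 := by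
        rw [← sq_eq_sq₀ (norm_nonneg _) (by positivity), hnorm]
        simp only [nullCoord]
        field_simp
        ring
      rw [hsplit, e1, nullCoord] at h1 h2
      rw [hsplit, hnorm, add_sub_cancel_left] at h3
      simp only [nullCoord] at h1 h2 h3
      have e2 : (l + ‖η‖ ^ 2 / l) / 2 + (l - ‖η‖ ^ 2 / l) / 2 = l := by ring
      rw [e2] at h1 h2
      have hl4 : 1 / 4 ≤ l := by linarith
      refine ⟨⟨by linarith, by linarith⟩, ?_⟩
      rw [Pi.smul_apply, smul_eq_mul, ← ENNReal.ofReal_mul hC0.le]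
      refine ENNReal.ofReal_le_ofReal ?_
      have hρ : ‖η‖ ^ 2 ≤ 4 := by nlinarith [sq_nonneg ‖η‖]
      have f1 : (1 + ‖η‖ ^ 2 / l ^ 2) / 2 ≤ 33 := by
        have : ‖η‖ ^ 2 / l ^ 2 ≤ 4 / (1 / 4) ^ 2 := by gcongr
        norm_num at this
        linarith
      have f2 : (19 / 400) ^ 2 ≤ bump a h l := by
        rw [bump, le_div_iff₀ (by positivity)]
        calc (19 / 400 : ℝ) ^ 2 * h ^ 4 = (19 / 400 * h ^ 2) ^ 2 := by ring
          _ ≤ _ := pow_le_pow_left₀ (by positivity) (by nlinarith) 2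
      have f3 : (7 : ℝ) ^ (-(m / 2 : ℝ)) ≤ l ^ (-(m / 2 : ℝ)) :=
        Real.rpow_le_rpow_of_nonpos hl (by linarith) (by simp; positivity)
      have f4 : Real.exp (-(16 * Real.pi)) ≤ Real.exp (-(Real.pi * β * ‖η‖ ^ 2 / l)) := by
        gcongr
        rw [div_le_iff₀ hl]
        have := Real.pi_pos
        calc Real.pi * β * ‖η‖ ^ 2 = Real.pi * (β * ‖η‖ ^ 2) := by ring
          _ ≤ Real.pi * 4 := by gcongr
          _ ≤ 16 * Real.pi * l := by nlinarith
      have f5 : (19 / 400 : ℝ) ^ 2 * (7 ^ (-(m / 2 : ℝ)) * Real.exp (-(16 * Real.pi))) ≤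
          capWeight a h β (l, η) := by
        rw [capWeight]
        gcongr
      calc (1 + ‖η‖ ^ 2 / l ^ 2) / 2 ≤ 33 := f1
        _ = C * ((19 / 400 : ℝ) ^ 2 * (7 ^ (-(m / 2 : ℝ)) * Real.exp (-(16 * Real.pi)))) := by
          rw [hC, Real.rpow_neg (by norm_num), Real.exp_neg]
          field_simp
        _ ≤ _ := by gcongr
    · rintro b η ⟨⟨h1, -⟩, -⟩
      have : ‖Φ (b, η)‖ = √(b ^ 2 + ‖η‖ ^ 2) := by
        exact (Real.sqrt_sq (norm_nonneg _)).symm.trans (by rw [hnorm])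
      rw [hsplit, this] at h1
      dsimp only at h1
      linarith
  · rw [integral_smul_measure, ENNReal.toReal_ofReal hC0.le, norm_smul,
      Real.norm_of_nonneg hC0.le]
    calc _ ≤ C * (32 * h * β ^ (-((m - 3) / 2 : ℝ)) * (β + |t|) ^ (-(3 / 2) : ℝ)) := by
          gcongr
          exact norm_integral_capMeasure_le hm hΦ.measurable hsurj hinner ha0 hh hβ0 hβh t x
      _ = _ := by ring

theorem exists_ball_majorant {m : ℕ} (hm : 3 ≤ m) : ∃ C : ℝ, 0 < C ∧
    ∀ (μ : ℝ) (c : Esp (m + 1)), 0 < μ → μ ≤ 1 → ∃ ν : Measure (Esp (m + 1)),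
      IsFiniteMeasure ν ∧ volume.restrict (ball c μ ∩ {ξ | 1 / 2 ≤ ‖ξ‖ ∧ ‖ξ‖ ≤ 2}) ≤ ν ∧
        ∀ t x, ‖∫ ξ, wavePhase t x ξ ∂ν‖ ≤
          C * μ ^ (m + 1) * (1 + μ ^ 2 * |t|) ^ (-(3 / 2) : ℝ) := by
  obtain ⟨K, hK, H⟩ := exists_cap_majorant hm
  have hm' : (3 : ℝ) ≤ m := by exact_mod_cast hm
  refine ⟨10 * K * 32 ^ (m + 1), by positivity, fun μ c hμ hμ1 => ?_⟩
  by_cases hne : (ball c μ ∩ {ξ | 1 / 2 ≤ ‖ξ‖ ∧ ‖ξ‖ ≤ 2}).Nonempty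
  swap
  · rw [Set.not_nonempty_iff_eq_empty.1 hne]
    refine ⟨0, inferInstance, by simp, fun t x => ?_⟩
    simp only [integral_zero_measure, norm_zero]
    positivity
  rcases le_or_gt μ (1 / 32) with hsmall | hlarge
  · obtain ⟨ξ₀, h1, h2, h3⟩ := hne
    rw [mem_ball, dist_eq_norm] at h1
    have n1 := norm_le_norm_add_norm_sub' ξ₀ c
    have n2 := norm_le_norm_add_norm_sub' c ξ₀
    rw [norm_sub_rev] at n2
    have hc : 0 < ‖c‖ := by linarith
    obtain ⟨ν, hν, hle, hb⟩ := H (‖c‖⁻¹ • c) (2 * ‖c‖ - 4 * μ) (8 * μ) (μ ^ 2)⁻¹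
      (by rw [norm_smul, norm_inv, norm_norm, inv_mul_cancel₀ hc.ne']) (by linarith) (by linarith)
      (by linarith) ((one_le_inv₀ (by positivity)).2 (by nlinarith))
      (by rw [inv_mul_eq_div, le_div_iff₀ (by positivity)]; nlinarith)
    refine ⟨ν, hν, (Measure.restrict_mono ?_ le_rfl).trans hle, fun t x => (hb t x).trans ?_⟩
    · rintro ξ ⟨k1, -⟩
      rw [mem_ball, dist_eq_norm] at k1
      have i1 : ⟪‖c‖⁻¹ • c, ξ⟫ * ‖c‖ = ⟪c, ξ⟫ := by
        rw [real_inner_smul_left]; field_simp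
      set p := ⟪‖c‖⁻¹ • c, ξ⟫ with hp
      have i2 : ‖ξ - c‖ ^ 2 = ‖ξ‖ ^ 2 - 2 * (p * ‖c‖) + ‖c‖ ^ 2 := by
        rw [i1, norm_sub_sq_real, real_inner_comm]
      have i3 : ‖ξ - c‖ ^ 2 ≤ μ ^ 2 := by gcongr
      have i4 : |‖ξ‖ - ‖c‖| ≤ μ := (abs_norm_sub_norm_le ξ c).trans k1.le
      have i5 : |p| ≤ ‖ξ‖ := by
        have := abs_real_inner_le_norm (‖c‖⁻¹ • c) ξ
        rwa [norm_smul, norm_inv, norm_norm, inv_mul_cancel₀ hc.ne', one_mul] at this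
      have i6 : |p - ‖c‖| ≤ μ := by
        refine abs_le_of_sq_le_sq ?_ hμ.le
        nlinarith [sq_abs p, abs_nonneg p]
      rw [abs_le] at i4 i6
      refine ⟨⟨by linarith, by linarith⟩, ?_⟩
      rw [inv_mul_le_iff₀ (by positivity)]
      nlinarith [sq_nonneg (p - ‖c‖)]
    · have e1 : ((μ ^ 2)⁻¹ : ℝ) ^ (-((m - 3) / 2 : ℝ)) = μ ^ (m - 3 : ℝ) := by
        rw [← Real.rpow_natCast, ← Real.rpow_neg hμ.le, ← Real.rpow_mul hμ.le]
        congr 1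
        push_cast
        ring
      have e2 : ((μ ^ 2)⁻¹ + |t|) ^ (-(3 / 2) : ℝ) =
          μ ^ (3 : ℝ) * (1 + μ ^ 2 * |t|) ^ (-(3 / 2) : ℝ) := by
        have : (μ ^ 2)⁻¹ + |t| = (μ ^ 2)⁻¹ * (1 + μ ^ 2 * |t|) := by field_simp
        rw [this, Real.mul_rpow (by positivity) (by positivity)]
        congr 1
        rw [← Real.rpow_natCast, ← Real.rpow_neg hμ.le, ← Real.rpow_mul hμ.le]
        norm_num
      have e3 : μ * μ ^ (m - 3 : ℝ) * μ ^ (3 : ℝ) = μ ^ (m + 1) := by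
        rw [mul_assoc, ← Real.rpow_add hμ, ← Real.rpow_one_add' hμ.le (by linarith),
          ← Real.rpow_natCast]
        congr 1
        push_cast
        ring
      rw [e1, e2]
      calc _ = 8 * K * (μ * μ ^ (m - 3 : ℝ) * μ ^ (3 : ℝ)) *
            (1 + μ ^ 2 * |t|) ^ (-(3 / 2) : ℝ) := by ring
        _ ≤ _ := by
          rw [e3]
          have : (1 : ℝ) ≤ 32 ^ (m + 1) := one_le_pow₀ (by norm_num)
          have : 8 * K ≤ 10 * K * 32 ^ (m + 1) := by nlinarith
          gcongr
  · have hw : ‖(EuclideanSpace.single 0 1 : Esp (m + 1))‖ = 1 := by simp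
    set w : Esp (m + 1) := EuclideanSpace.single 0 1
    obtain ⟨ν₁, hν₁, hle₁, hb₁⟩ := H w (1 / 4) 5 1 hw le_rfl (by norm_num) (by norm_num) le_rfl
      (by norm_num)
    obtain ⟨ν₂, hν₂, hle₂, hb₂⟩ := H (-w) (1 / 4) 5 1 (by rwa [norm_neg]) le_rfl (by norm_num)
      (by norm_num) le_rfl (by norm_num)
    refine ⟨ν₁ + ν₂, inferInstance, ?_, fun t x => ?_⟩
    · refine (Measure.restrict_mono ?_ le_rfl).trans
        ((Measure.restrict_union_le _ _).trans (add_le_add hle₁ hle₂))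
      rintro ξ ⟨-, k1, k2⟩
      have i5 : |⟪w, ξ⟫| ≤ ‖ξ‖ := by
        have := abs_real_inner_le_norm w ξ
        rwa [hw, one_mul] at this
      have i6 : ‖ξ‖ ^ 2 ≤ 4 := by nlinarith
      rcases le_total 0 ⟪w, ξ⟫ with hs | hs
      · left
        rw [abs_of_nonneg hs] at i5
        refine ⟨⟨by linarith, by linarith⟩, by nlinarith⟩
      · right
        rw [abs_of_nonpos hs] at i5
        simp only [Set.mem_ofPred_eq, inner_neg_left]
        refine ⟨⟨by linarith, by linarith⟩, by nlinarith⟩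
    · rw [integral_add_measure (integrable_wavePhase ν₁ t x) (integrable_wavePhase ν₂ t x)]
      have k1 := hb₁ t x
      have k2 := hb₂ t x
      rw [Real.one_rpow] at k1 k2
      have k3 : (1 + |t|) ^ (-(3 / 2) : ℝ) ≤ (1 + μ ^ 2 * |t|) ^ (-(3 / 2) : ℝ) := by
        refine Real.rpow_le_rpow_of_nonpos (by positivity) ?_ (by norm_num)
        have : μ ^ 2 * |t| ≤ |t| := mul_le_of_le_one_left (abs_nonneg t) (by nlinarith)
        linarith
      have k4 : (1 : ℝ) ≤ 32 ^ (m + 1) * μ ^ (m + 1) := by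
        rw [← mul_pow]
        exact one_le_pow₀ (by linarith)
      calc _ ≤ 10 * K * 1 * (1 + |t|) ^ (-(3 / 2) : ℝ) := (norm_add_le _ _).trans (by linarith)
        _ ≤ 10 * K * (32 ^ (m + 1) * μ ^ (m + 1)) * (1 + μ ^ 2 * |t|) ^ (-(3 / 2) : ℝ) := by gcongr
        _ = _ := by ring

theorem wavePhase_mul_conj {n : ℕ} (t s : ℝ) (x y ξ : Esp n) :
    wavePhase t x ξ * starRingEnd ℂ (wavePhase s y ξ) = wavePhase (t - s) (x - y) ξ := by
  unfold wavePhase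
  rw [← Complex.exp_conj, ← Complex.exp_add, inner_sub_left]
  congr 1
  simp only [map_mul, Complex.conj_I, Complex.conj_ofReal, map_ofNat]
  push_cast
  ring

theorem integral_norm_sq_superposition_le {n : ℕ} (ν : Measure (Esp n)) [IsFiniteMeasure ν]
    {M : ℝ → ℝ} (hM : Integrable M) (hK : ∀ t x, ‖∫ ξ, wavePhase t x ξ ∂ν‖ ≤ M t)
    {F : ℝ → ℂ} (hF : Integrable F) (hF2 : Integrable fun t => ‖F t‖ ^ 2)
    {x : ℝ → Esp n} (hx : Measurable x) :
    ∫ ξ, ‖∫ t, F t * wavePhase t (x t) ξ‖ ^ 2 ∂ν ≤ (∫ t, M t) * ∫ t, ‖F t‖ ^ 2 := by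
  obtain ⟨G, hGdef⟩ : ∃ G : ℝ × ℝ → ℂ, G = fun p => F p.1 * starRingEnd ℂ (F p.2) := ⟨_, rfl⟩
  have hG : Integrable G (volume.prod volume) := by
    rw [hGdef]
    exact hF.mul_prod (Complex.conjCLE.toContinuousLinearMap.integrable_comp hF)
  have hGn : ∀ p, ‖G p‖ = ‖F p.1‖ * ‖F p.2‖ := fun p => by simp [hGdef]
  have hE : Measurable fun q : Esp n × ℝ × ℝ =>
      wavePhase (q.2.1 - q.2.2) (x q.2.1 - x q.2.2) q.1 := by
    unfold wavePhase
    fun_prop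
  have hsq : ∀ ξ, ((‖∫ t, F t * wavePhase t (x t) ξ‖ ^ 2 : ℝ) : ℂ) =
      ∫ p, G p * wavePhase (p.1 - p.2) (x p.1 - x p.2) ξ ∂(volume.prod volume) := by
    intro ξ
    rw [Complex.ofReal_pow, ← Complex.mul_conj', ← integral_conj, ← integral_prod_mul]
    refine integral_congr_ae (ae_of_all _ fun p => ?_)
    simp only [map_mul, hGdef, ← wavePhase_mul_conj]
    ring
  have h_int : Integrable (Function.uncurry fun ξ (p : ℝ × ℝ) =>
      G p * wavePhase (p.1 - p.2) (x p.1 - x p.2) ξ) (ν.prod (volume.prod volume)) := by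
    refine (hG.comp_snd ν).norm.mono' ((hG.comp_snd ν).1.mul hE.aestronglyMeasurable)
      (ae_of_all _ fun q => ?_)
    simp only [Function.uncurry, norm_mul, norm_wavePhase, mul_one, le_refl]
  have hswap : ((∫ ξ, ‖∫ t, F t * wavePhase t (x t) ξ‖ ^ 2 ∂ν : ℝ) : ℂ) =
      ∫ p, G p * ∫ ξ, wavePhase (p.1 - p.2) (x p.1 - x p.2) ξ ∂ν ∂(volume.prod volume) := by
    rw [← integral_complex_ofReal]
    simp_rw [hsq]
    rw [integral_integral_swap h_int]
    simp_rw [integral_const_mul]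
  have i2 : Integrable (fun p : ℝ × ℝ => ‖F p.2‖ ^ 2 * M (p.1 - p.2)) (volume.prod volume) :=
    hF2.convolution_integrand (ContinuousLinearMap.mul ℝ ℝ) hM
  have i1 : Integrable (fun p : ℝ × ℝ => ‖F p.1‖ ^ 2 * M (p.1 - p.2)) (volume.prod volume) := by
    have := (hF2.convolution_integrand (ContinuousLinearMap.mul ℝ ℝ) hM.comp_neg).swap
    simpa [Function.comp_def] using this
  have e1 : ∫ p : ℝ × ℝ, ‖F p.1‖ ^ 2 * M (p.1 - p.2) ∂(volume.prod volume) =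
      (∫ t, M t) * ∫ t, ‖F t‖ ^ 2 := by
    rw [integral_prod _ i1]
    simp_rw [integral_const_mul, integral_sub_left_eq_self M volume, integral_mul_const]
    rw [mul_comm]
  have e2 : ∫ p : ℝ × ℝ, ‖F p.2‖ ^ 2 * M (p.1 - p.2) ∂(volume.prod volume) =
      (∫ t, M t) * ∫ t, ‖F t‖ ^ 2 := by
    rw [integral_prod_symm _ i2]
    simp_rw [integral_const_mul, integral_sub_right_eq_self M, integral_mul_const]
    rw [mul_comm]
  have h0 : 0 ≤ ∫ ξ, ‖∫ t, F t * wavePhase t (x t) ξ‖ ^ 2 ∂ν :=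
    integral_nonneg fun ξ => by positivity
  rw [← abs_of_nonneg h0, ← Real.norm_eq_abs, ← Complex.norm_real, hswap]
  calc _ ≤ ∫ p : ℝ × ℝ, 2⁻¹ * (‖F p.1‖ ^ 2 * M (p.1 - p.2) + ‖F p.2‖ ^ 2 * M (p.1 - p.2))
        ∂(volume.prod volume) := by
        refine norm_integral_le_of_norm_le ((i1.add i2).const_mul _) (ae_of_all _ fun p => ?_)
        rw [norm_mul, hGn]
        have k := hK (p.1 - p.2) (x p.1 - x p.2)
        have k0 := (norm_nonneg _).trans k
        calc _ ≤ ‖F p.1‖ * ‖F p.2‖ * M (p.1 - p.2) := by gcongr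
          _ ≤ (2⁻¹ * (‖F p.1‖ ^ 2 + ‖F p.2‖ ^ 2)) * M (p.1 - p.2) := by
            refine mul_le_mul_of_nonneg_right ?_ k0
            nlinarith [sq_nonneg (‖F p.1‖ - ‖F p.2‖)]
          _ = _ := by ring
    _ = _ := by
      rw [integral_const_mul, integral_add i1 i2, e1, e2]
      ring

/-- The half wave `e^{2πit|D|}` applied to a function with Fourier transform `g`. -/
def halfWave {n : ℕ} (g : Esp n → ℂ) (t : ℝ) (x : Esp n) : ℂ :=
  ∫ ξ, wavePhase t x ξ * g ξ

theorem continuous_halfWave {n : ℕ} {g : Esp n → ℂ} (hg : Integrable g) :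
    Continuous fun p : ℝ × Esp n => halfWave g p.1 p.2 := by
  unfold halfWave
  refine continuous_of_dominated (bound := fun ξ => ‖g ξ‖) (fun p => ?_)
    (fun p => ae_of_all _ fun ξ => ?_) hg.norm (ae_of_all _ fun ξ => ?_)
  · have : Continuous (wavePhase p.1 p.2) :=
      continuous_wavePhase.comp (by fun_prop : Continuous fun ξ : Esp n => (p.1, p.2, ξ))
    exact this.aestronglyMeasurable.mul hg.1
  · rw [norm_mul, norm_wavePhase, one_mul]
  · unfold wavePhase
    fun_prop

theorem measurable_halfWave_comp {n : ℕ} {g : Esp n → ℂ} (hg : Integrable g) {x : ℝ → Esp n}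
    (hx : Measurable x) : Measurable fun t => halfWave g t (x t) := by
  have h : Measurable fun p : ℝ × Esp n => halfWave g p.1 p.2 :=
    (continuous_halfWave hg).measurable
  fun_prop

theorem norm_halfWave_le {n : ℕ} (g : Esp n → ℂ) (t : ℝ) (x : Esp n) :
    ‖halfWave g t x‖ ≤ ∫ ξ, ‖g ξ‖ := by
  refine (norm_integral_le_integral_norm _).trans (le_of_eq ?_)
  simp only [norm_mul, norm_wavePhase, one_mul]

theorem setIntegral_norm_sq_halfWave_le {n : ℕ} {S : Set (Esp n)} (hS : MeasurableSet S)
    (ν : Measure (Esp n)) [IsFiniteMeasure ν] (hν : volume.restrict S ≤ ν)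
    {M : ℝ → ℝ} (hM : Integrable M) (hM0 : 0 < ∫ t, M t)
    (hK : ∀ t x, ‖∫ ξ, wavePhase t x ξ ∂ν‖ ≤ M t)
    {g : Esp n → ℂ} (hg : Integrable g) (hg2 : Integrable fun ξ => ‖g ξ‖ ^ 2)
    (hgS : Function.support g ⊆ S) {x : ℝ → Esp n} (hx : Measurable x) (T : ℝ) :
    ∫ t in Set.Icc (-T) T, ‖halfWave g t (x t)‖ ^ 2 ≤ (∫ t, M t) * ∫ ξ, ‖g ξ‖ ^ 2 := by
  set A := ∫ t, M t
  have hUm := measurable_halfWave_comp hg hx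
  obtain ⟨F, hF⟩ : ∃ F : ℝ → ℂ, F = (Set.Icc (-T) T).indicator
    (fun t => starRingEnd ℂ (halfWave g t (x t))) := ⟨_, rfl⟩
  have hconj : Measurable fun t => starRingEnd ℂ (halfWave g t (x t)) :=
    Complex.continuous_conj.measurable.comp hUm
  have hFm : Measurable F := hF ▸ hconj.indicator measurableSet_Icc
  have hFint : Integrable F := by
    rw [hF, integrable_indicator_iff measurableSet_Icc]
    refine Measure.integrableOn_of_bounded (M := ∫ ξ, ‖g ξ‖) measure_Icc_lt_top.ne
      hconj.aestronglyMeasurable (ae_of_all _ fun t => ?_)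
    rw [RCLike.norm_conj]
    exact norm_halfWave_le g t (x t)
  have hFb : ∀ t, ‖F t‖ ≤ ∫ ξ, ‖g ξ‖ := fun t => by
    rw [hF]
    refine (norm_indicator_le_norm_self _ _).trans ?_
    rw [RCLike.norm_conj]
    exact norm_halfWave_le g t (x t)
  have hF2 : Integrable fun t => ‖F t‖ ^ 2 := by
    refine (hFint.norm.const_mul (∫ ξ, ‖g ξ‖)).mono' (by fun_prop) (ae_of_all _ fun t => ?_)
    rw [Real.norm_of_nonneg (by positivity), sq]
    exact mul_le_mul_of_nonneg_right (hFb t) (norm_nonneg _)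
  have hX : ∫ t in Set.Icc (-T) T, ‖halfWave g t (x t)‖ ^ 2 = ∫ t, ‖F t‖ ^ 2 := by
    rw [← integral_indicator measurableSet_Icc]
    refine integral_congr_ae (ae_of_all _ fun t => ?_)
    by_cases ht : t ∈ Set.Icc (-T) T <;> simp [hF, ht]
  rw [hX]
  set X := ∫ t, ‖F t‖ ^ 2 with hXdef
  obtain ⟨H, hH⟩ : ∃ H : Esp n → ℂ, H = fun ξ => ∫ t, F t * wavePhase t (x t) ξ := ⟨_, rfl⟩
  have hE : Measurable fun p : ℝ × Esp n => wavePhase p.1 (x p.1) p.2 := by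
    unfold wavePhase
    fun_prop
  have hHm : StronglyMeasurable H := by
    rw [hH]
    refine StronglyMeasurable.integral_prod_left (Measurable.stronglyMeasurable ?_)
    exact (hFm.comp measurable_fst).mul hE
  have hHb : ∀ ξ, ‖H ξ‖ ≤ ∫ t, ‖F t‖ := fun ξ => by
    rw [hH]
    refine (norm_integral_le_integral_norm _).trans (le_of_eq ?_)
    simp only [norm_mul, norm_wavePhase, mul_one]
  have hHν : Integrable (fun ξ => ‖H ξ‖ ^ 2) ν := by
    refine (integrable_const ((∫ t, ‖F t‖) ^ 2)).mono' (hHm.norm.pow 2).aestronglyMeasurable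
      (ae_of_all _ fun ξ => ?_)
    rw [Real.norm_of_nonneg (by positivity)]
    gcongr
    exact hHb ξ
  have hdual : ∫ ξ, ‖H ξ‖ ^ 2 ∂ν ≤ A * X := by
    rw [hH]
    exact integral_norm_sq_superposition_le ν hM hK hFint hF2 hx
  have hHS : ∫ ξ in S, ‖H ξ‖ ^ 2 ≤ A * X :=
    (integral_mono_measure hν (ae_of_all _ fun ξ => by positivity) hHν).trans hdual
  have h_int : Integrable (Function.uncurry fun t ξ => F t * (wavePhase t (x t) ξ * g ξ))
      (volume.prod volume) := by
    refine (hFint.mul_prod hg).norm.mono' (hFint.1.comp_fst.mul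
      (hE.aestronglyMeasurable.mul hg.1.comp_snd)) (ae_of_all _ fun p => ?_)
    simp only [Function.uncurry, norm_mul, norm_wavePhase, one_mul, le_refl]
  have hpair : (X : ℂ) = ∫ ξ, g ξ * H ξ := by
    calc (X : ℂ) = ∫ t, F t * halfWave g t (x t) := by
          rw [hXdef, ← integral_complex_ofReal]
          refine integral_congr_ae (ae_of_all _ fun t => ?_)
          by_cases ht : t ∈ Set.Icc (-T) T
          · simp [hF, ht, Complex.conj_mul']
          · simp [hF, ht]
      _ = ∫ t, ∫ ξ, F t * (wavePhase t (x t) ξ * g ξ) := by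
          simp_rw [integral_const_mul]
          rfl
      _ = ∫ ξ, ∫ t, F t * (wavePhase t (x t) ξ * g ξ) := integral_integral_swap h_int
      _ = ∫ ξ, g ξ * H ξ := by
          rw [hH]
          simp_rw [← integral_const_mul]
          refine integral_congr_ae (ae_of_all _ fun ξ =>
            integral_congr_ae (ae_of_all _ fun t => ?_))
          dsimp only
          ring
  have hX0 : 0 ≤ X := integral_nonneg fun t => by positivity
  have hHSi : Integrable (S.indicator fun ξ => ‖H ξ‖ ^ 2) :=
    (integrable_indicator_iff hS).2 (hHν.mono_measure hν)
  have hle : X ≤ A / 2 * (∫ ξ, ‖g ξ‖ ^ 2) + 1 / (2 * A) * (A * X) := by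
    calc X = ‖(X : ℂ)‖ := by rw [Complex.norm_real, Real.norm_of_nonneg hX0]
      _ ≤ ∫ ξ, (A / 2 * ‖g ξ‖ ^ 2 + 1 / (2 * A) * S.indicator (fun ξ => ‖H ξ‖ ^ 2) ξ) := by
        rw [hpair]
        refine norm_integral_le_of_norm_le ((hg2.const_mul _).add (hHSi.const_mul _))
          (ae_of_all _ fun ξ => ?_)
        by_cases hξ : ξ ∈ S
        · rw [Set.indicator_of_mem hξ, norm_mul]
          have : A / 2 * ‖g ξ‖ ^ 2 + 1 / (2 * A) * ‖H ξ‖ ^ 2 - ‖g ξ‖ * ‖H ξ‖ =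
            (A * ‖g ξ‖ - ‖H ξ‖) ^ 2 / (2 * A) := by field_simp; ring
          have h2 : 0 ≤ (A * ‖g ξ‖ - ‖H ξ‖) ^ 2 / (2 * A) := by positivity
          linarith
        · rw [Set.indicator_of_notMem hξ, Function.notMem_support.1 fun h => hξ (hgS h)]
          simp
      _ = A / 2 * (∫ ξ, ‖g ξ‖ ^ 2) + 1 / (2 * A) * ∫ ξ in S, ‖H ξ‖ ^ 2 := by
        rw [integral_add (hg2.const_mul _) (hHSi.const_mul _), integral_const_mul,
          integral_const_mul, integral_indicator hS]
      _ ≤ _ := by gcongr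
  have : 1 / (2 * A) * (A * X) = X / 2 := by field_simp
  linarith

theorem ofReal_integral_norm_sq {α E : Type*} [MeasurableSpace α] [NormedAddCommGroup E]
    {κ : Measure α} {f : α → E} (hf : Integrable (fun a => ‖f a‖ ^ 2) κ) :
    ENNReal.ofReal (∫ a, ‖f a‖ ^ 2 ∂κ) = ∫⁻ a, ‖f a‖ₑ ^ 2 ∂κ := by
  rw [ofReal_integral_eq_lintegral_ofReal hf (ae_of_all _ fun a => by positivity)]
  simp_rw [← ofReal_norm, ENNReal.ofReal_pow (norm_nonneg _)]

/-- The supremum of `|e^{2πit|D|}f|` over a countable dense set of points. -/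
def halfSup {n : ℕ} (g : Esp n → ℂ) (t : ℝ) : ℝ≥0∞ :=
  ⨆ k, ‖halfWave g t (TopologicalSpace.denseSeq (Esp n) k)‖ₑ

theorem measurable_halfSup {n : ℕ} {g : Esp n → ℂ} (hg : Integrable g) :
    Measurable (halfSup g) :=
  Measurable.iSup fun _ => (measurable_halfWave_comp hg measurable_const).enorm

theorem enorm_halfWave_le_halfSup {n : ℕ} {g : Esp n → ℂ} (hg : Integrable g) (t : ℝ)
    (x : Esp n) : ‖halfWave g t x‖ₑ ≤ halfSup g t := by
  have hc : Continuous fun x => ‖halfWave g t x‖ₑ := by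
    have := continuous_halfWave hg
    exact (this.comp (by fun_prop : Continuous fun x : Esp n => (t, x))).enorm
  have hcl : IsClosed {x | ‖halfWave g t x‖ₑ ≤ halfSup g t} := isClosed_le hc continuous_const
  have hd := (TopologicalSpace.denseRange_denseSeq (Esp n)).closure_range
  have hsub : Set.range (TopologicalSpace.denseSeq (Esp n)) ⊆
      {x | ‖halfWave g t x‖ₑ ≤ halfSup g t} := by
    rintro _ ⟨k, rfl⟩
    exact le_iSup (fun k => ‖halfWave g t (TopologicalSpace.denseSeq (Esp n) k)‖ₑ) k
  have := hcl.closure_subset_iff.2 hsub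
  rw [hd] at this
  exact this (Set.mem_univ x)

/-- A point maximizing `|e^{2πit|D|}f|` among the first `N + 1` points of a dense sequence. -/
def maxPoint {n : ℕ} (g : Esp n → ℂ) : ℕ → ℝ → Esp n
  | 0, _ => TopologicalSpace.denseSeq (Esp n) 0
  | N + 1, t =>
    if ‖halfWave g t (maxPoint g N t)‖ < ‖halfWave g t (TopologicalSpace.denseSeq (Esp n) (N + 1))‖
    then TopologicalSpace.denseSeq (Esp n) (N + 1) else maxPoint g N t

theorem measurable_maxPoint {n : ℕ} {g : Esp n → ℂ} (hg : Integrable g) (N : ℕ) :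
    Measurable (maxPoint g N) := by
  induction N with
  | zero => exact measurable_const
  | succ N ih =>
    have : maxPoint g (N + 1) = fun t => if ‖halfWave g t (maxPoint g N t)‖ <
        ‖halfWave g t (TopologicalSpace.denseSeq (Esp n) (N + 1))‖
      then TopologicalSpace.denseSeq (Esp n) (N + 1) else maxPoint g N t := by
      funext t
      rw [maxPoint]
    rw [this]
    refine Measurable.ite (measurableSet_lt (measurable_halfWave_comp hg ih).norm
      (measurable_halfWave_comp hg measurable_const).norm) measurable_const ih

theorem norm_halfWave_maxPoint_le_succ {n : ℕ} (g : Esp n → ℂ) (N : ℕ) (t : ℝ) :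
    ‖halfWave g t (maxPoint g N t)‖ ≤ ‖halfWave g t (maxPoint g (N + 1) t)‖ := by
  rw [maxPoint]
  split_ifs with h
  · exact h.le
  · exact le_rfl

theorem norm_halfWave_denseSeq_le {n : ℕ} (g : Esp n → ℂ) (N : ℕ) (t : ℝ) :
    ‖halfWave g t (TopologicalSpace.denseSeq (Esp n) N)‖ ≤ ‖halfWave g t (maxPoint g N t)‖ := by
  cases N with
  | zero => exact le_rfl
  | succ N =>
    rw [maxPoint]
    split_ifs with h
    · exact le_rfl
    · exact not_lt.1 h

theorem lintegral_halfSup_sq_le {n : ℕ} {S : Set (Esp n)} (hS : MeasurableSet S)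
    (ν : Measure (Esp n)) [IsFiniteMeasure ν] (hν : volume.restrict S ≤ ν)
    {M : ℝ → ℝ} (hM : Integrable M) (hM0 : 0 < ∫ t, M t)
    (hK : ∀ t x, ‖∫ ξ, wavePhase t x ξ ∂ν‖ ≤ M t)
    {g : Esp n → ℂ} (hg : Integrable g) (hg2 : Integrable fun ξ => ‖g ξ‖ ^ 2)
    (hgS : Function.support g ⊆ S) :
    ∫⁻ t, halfSup g t ^ 2 ≤ ENNReal.ofReal (∫ t, M t) * ∫⁻ ξ, ‖g ξ‖ₑ ^ 2 := by
  obtain ⟨φ, hφ⟩ : ∃ φ : ℕ → ℝ → ℝ≥0∞, φ = fun (N : ℕ) => (Set.Icc (-(N : ℝ)) N).indicator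
    fun t => ‖halfWave g t (maxPoint g N t)‖ₑ ^ 2 := ⟨_, rfl⟩
  have hUm := fun N => measurable_halfWave_comp hg (measurable_maxPoint hg N)
  have hmono : Monotone φ := by
    refine monotone_nat_of_le_succ fun N t => ?_
    rw [hφ]
    refine (Set.indicator_le_indicator_of_subset (s := Set.Icc (-(N : ℝ)) N)
      (t := Set.Icc (-((N + 1 : ℕ) : ℝ)) (N + 1 : ℕ)) ?_ (fun _ => zero_le) t).trans
      (Set.indicator_le_indicator ?_)
    · refine Set.Icc_subset_Icc ?_ ?_ <;> push_cast <;> linarith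
    · gcongr
      exact enorm_le_iff_norm_le.2 (norm_halfWave_maxPoint_le_succ g N t)
  have h_int : ∀ N, ∫⁻ t, φ N t ≤ ENNReal.ofReal (∫ t, M t) * ∫⁻ ξ, ‖g ξ‖ₑ ^ 2 := by
    intro N
    rw [hφ, lintegral_indicator measurableSet_Icc, ← ofReal_integral_norm_sq hg2,
      ← ofReal_integral_norm_sq, ← ENNReal.ofReal_mul hM0.le]
    · exact ENNReal.ofReal_le_ofReal (setIntegral_norm_sq_halfWave_le hS ν hν hM hM0 hK hg hg2 hgS
        (measurable_maxPoint hg N) N)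
    · refine Measure.integrableOn_of_bounded (M := (∫ ξ, ‖g ξ‖) ^ 2) measure_Icc_lt_top.ne
        ((hUm N).norm.pow_const 2).aestronglyMeasurable (ae_of_all _ fun t => ?_)
      rw [Real.norm_of_nonneg (by positivity)]
      gcongr
      exact norm_halfWave_le g t _
  have hle : ∀ t, halfSup g t ^ 2 ≤ ⨆ N, φ N t := by
    intro t
    have : halfSup g t ^ 2 = ⨆ k, ‖halfWave g t (TopologicalSpace.denseSeq (Esp n) k)‖ₑ ^ 2 :=
      ENNReal.iSup_pow _ _
    rw [this]
    refine iSup_le fun k => ?_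
    obtain ⟨N, hN⟩ := exists_nat_ge |t|
    refine le_trans ?_ (le_iSup_of_le (max k N) le_rfl)
    have ht : t ∈ Set.Icc (-((max k N : ℕ) : ℝ)) (max k N : ℕ) := by
      have : (N : ℝ) ≤ (max k N : ℕ) := by exact_mod_cast le_max_right k N
      exact abs_le.1 (hN.trans this)
    have hm : Monotone fun N => ‖halfWave g t (maxPoint g N t)‖ :=
      monotone_nat_of_le_succ fun N => norm_halfWave_maxPoint_le_succ g N t
    rw [hφ]
    dsimp only
    rw [Set.indicator_of_mem ht]
    gcongr
    exact enorm_le_iff_norm_le.2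
      ((norm_halfWave_denseSeq_le g k t).trans (hm (le_max_left k N)))
  calc ∫⁻ t, halfSup g t ^ 2 ≤ ∫⁻ t, ⨆ N, φ N t := lintegral_mono hle
    _ = ⨆ N, ∫⁻ t, φ N t := by
      refine lintegral_iSup (fun N => ?_) hmono
      rw [hφ]
      exact ((hUm N).enorm.pow_const 2).indicator measurableSet_Icc
    _ ≤ _ := iSup_le h_int

theorem exists_integral_decay (k : ℕ) : ∃ K : ℝ, 0 < K ∧ ∀ (C μ : ℝ), 0 < C → 0 < μ →
    Integrable (fun t : ℝ => C * μ ^ (k + 2) * (1 + μ ^ 2 * |t|) ^ (-(3 / 2) : ℝ)) ∧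
    ∫ t : ℝ, C * μ ^ (k + 2) * (1 + μ ^ 2 * |t|) ^ (-(3 / 2) : ℝ) = C * K * μ ^ k := by
  have hI : Integrable fun t : ℝ => (1 + |t|) ^ (-(3 / 2) : ℝ) := by
    simpa using! integrable_one_add_norm (E := ℝ) (μ := volume) (r := 3 / 2) (by norm_num)
  refine ⟨∫ t : ℝ, (1 + |t|) ^ (-(3 / 2) : ℝ), ?_, fun C μ hC hμ => ?_⟩
  · refine (integral_pos_iff_support_of_nonneg (fun t => by positivity) hI).2 ?_
    have : Function.support (fun t : ℝ => (1 + |t|) ^ (-(3 / 2) : ℝ)) = Set.univ := by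
      ext t
      simpa using! (by positivity : (1 + |t|) ^ (-(3 / 2) : ℝ) ≠ 0)
    simp [this]
  · have heq : (fun t : ℝ => C * μ ^ (k + 2) * (1 + μ ^ 2 * |t|) ^ (-(3 / 2) : ℝ)) =
        fun t => C * μ ^ (k + 2) * (1 + |μ ^ 2 * t|) ^ (-(3 / 2) : ℝ) := by
      funext t
      rw [abs_mul, abs_of_nonneg (by positivity : 0 ≤ μ ^ 2)]
    rw [heq]
    refine ⟨(hI.comp_mul_left' (by positivity : μ ^ 2 ≠ 0)).const_mul _, ?_⟩
    rw [integral_const_mul,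
      Measure.integral_comp_mul_left (fun t : ℝ => (1 + |t|) ^ (-(3 / 2) : ℝ)) (μ ^ 2),
      abs_of_nonneg (by positivity), smul_eq_mul]
    field_simp
    ring

/-- The Fourier amplitude of one of the two half-waves making up a localized free wave. -/
def halfAmplitude {n : ℕ} (χ : Esp n → ℝ) (F0 F1 : Esp n → ℂ) (s : ℝ) (ξ : Esp n) : ℂ :=
  (χ ξ : ℂ) * (F0 ξ / 2 + ((s / (4 * Real.pi * ‖ξ‖) : ℝ) : ℂ) / Complex.I * F1 ξ)

theorem support_halfAmplitude {n : ℕ} (χ : Esp n → ℝ) (F0 F1 : Esp n → ℂ) (s : ℝ) :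
    Function.support (halfAmplitude χ F0 F1 s) ⊆
      Function.support χ ∩ (Function.support F0 ∪ Function.support F1) := by
  intro ξ hξ
  refine ⟨fun h => hξ (by simp [halfAmplitude, h]), ?_⟩
  by_contra h
  simp only [Set.mem_union, Function.mem_support, not_or, not_not] at h
  exact hξ (by simp [halfAmplitude, h])

theorem norm_halfAmplitude_le {n : ℕ} {χ : Esp n → ℝ} {F0 F1 : Esp n → ℂ} {s : ℝ}
    (hs : |s| = 1) {ξ : Esp n} (hF1 : F1 ξ ≠ 0 → 1 / 2 ≤ ‖ξ‖) :
    ‖halfAmplitude χ F0 F1 s ξ‖ ≤ |χ ξ| * (‖F0 ξ‖ + ‖F1 ξ‖) := by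
  rw [halfAmplitude, norm_mul, Complex.norm_real, Real.norm_eq_abs]
  refine mul_le_mul_of_nonneg_left ((norm_add_le _ _).trans (add_le_add ?_ ?_)) (abs_nonneg _)
  · rw [norm_div]
    simp
  · rcases eq_or_ne (F1 ξ) 0 with h | h
    · simp [h]
    · have hξ := hF1 h
      rw [norm_mul, norm_div, Complex.norm_I, div_one, Complex.norm_real, Real.norm_eq_abs,
        abs_div, hs, abs_of_nonneg (by positivity)]
      refine mul_le_of_le_one_left (norm_nonneg _) ?_
      rw [div_le_one (by positivity)]
      nlinarith [Real.pi_gt_three]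

theorem aestronglyMeasurable_halfAmplitude {n : ℕ} {χ : Esp n → ℝ} (hχ : Continuous χ)
    {F0 F1 : Esp n → ℂ} (h0 : AEStronglyMeasurable F0) (h1 : AEStronglyMeasurable F1) (s : ℝ) :
    AEStronglyMeasurable (halfAmplitude χ F0 F1 s) := by
  have ha : Measurable fun ξ : Esp n => ((s / (4 * Real.pi * ‖ξ‖) : ℝ) : ℂ) / Complex.I := by
    fun_prop
  have hc : Continuous fun ξ : Esp n => (χ ξ : ℂ) := by fun_prop
  have h2 : AEStronglyMeasurable fun ξ => F0 ξ / 2 := by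
    simpa [div_eq_mul_inv] using! h0.mul_const (2 : ℂ)⁻¹
  exact hc.aestronglyMeasurable.mul (h2.add (ha.aestronglyMeasurable.mul h1))

theorem integrable_halfAmplitude {n : ℕ} {χ : Esp n → ℝ} (hχ : Continuous χ)
    (hχ1 : ∀ ξ, 0 ≤ χ ξ ∧ χ ξ ≤ 1) {F0 F1 : Esp n → ℂ} (h0 : Integrable F0) (h1 : Integrable F1)
    {s : ℝ} (hs : |s| = 1) (hF1 : ∀ ξ, F1 ξ ≠ 0 → 1 / 2 ≤ ‖ξ‖) :
    Integrable (halfAmplitude χ F0 F1 s) := by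
  refine (h0.norm.add h1.norm).mono' (aestronglyMeasurable_halfAmplitude hχ h0.1 h1.1 s)
    (ae_of_all _ fun ξ => (norm_halfAmplitude_le hs (hF1 ξ)).trans ?_)
  refine mul_le_of_le_one_left (by positivity) ?_
  rw [abs_of_nonneg (hχ1 ξ).1]
  exact (hχ1 ξ).2

theorem wavePiece_eq_add {n : ℕ} {χ : Esp n → ℝ} {f0 f1 : Esp n → ℂ}
    (hp : Integrable (halfAmplitude χ (𝓕 f0) (𝓕 f1) 1))
    (hm : Integrable (halfAmplitude χ (𝓕 f0) (𝓕 f1) (-1))) (t : ℝ) (x : Esp n) :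
    wavePiece n χ f0 f1 t x = halfWave (halfAmplitude χ (𝓕 f0) (𝓕 f1) 1) t x +
      halfWave (halfAmplitude χ (𝓕 f0) (𝓕 f1) (-1)) (-t) x := by
  have h_int : ∀ (g : Esp n → ℂ) (t : ℝ), Integrable g →
      Integrable fun ξ => wavePhase t x ξ * g ξ := by
    intro g t hg
    refine hg.norm.mono' (AEStronglyMeasurable.mul ?_ hg.1) (ae_of_all _ fun ξ => ?_)
    · have : Continuous fun ξ => wavePhase t x ξ := by
        unfold wavePhase
        fun_prop
      exact this.aestronglyMeasurable
    · rw [norm_mul, norm_wavePhase, one_mul]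
  rw [halfWave, halfWave, ← integral_add (h_int _ _ hp) (h_int _ _ hm), wavePiece]
  congr 1
  funext ξ
  have hexp : ∀ t : ℝ, wavePhase t x ξ = Complex.exp (2 * Real.pi * Complex.I * (⟪x, ξ⟫ : ℝ)) *
      (Complex.cos ((2 * Real.pi * t * ‖ξ‖ : ℝ) : ℂ) +
        Complex.sin ((2 * Real.pi * t * ‖ξ‖ : ℝ) : ℂ) * Complex.I) := by
    intro t
    rw [← Complex.exp_mul_I, ← Complex.exp_add, wavePhase]
    congr 1
    push_cast
    ring
  rw [hexp, hexp, halfAmplitude, halfAmplitude]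
  have hI : Complex.I ^ 2 = -1 := Complex.I_sq
  have hneg : ((2 * Real.pi * -t * ‖ξ‖ : ℝ) : ℂ) = -((2 * Real.pi * t * ‖ξ‖ : ℝ) : ℂ) := by
    push_cast
    ring
  rw [hneg, Complex.cos_neg, Complex.sin_neg, Complex.ofReal_cos, Complex.ofReal_div,
    Complex.ofReal_sin]
  rcases eq_or_ne ξ 0 with rfl | hξ
  · simp
    ring
  · have hn : ((‖ξ‖ : ℝ) : ℂ) ≠ 0 := by simpa using! hξ
    have hpi : ((Real.pi : ℝ) : ℂ) ≠ 0 := by simp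
    generalize Complex.cos ((2 * Real.pi * t * ‖ξ‖ : ℝ) : ℂ) = c
    generalize Complex.sin ((2 * Real.pi * t * ‖ξ‖ : ℝ) : ℂ) = d
    push_cast
    field_simp
    ring

theorem eLpNorm_two_sq {α E : Type*} [MeasurableSpace α] [NormedAddCommGroup E] (κ : Measure α)
    (f : α → E) : eLpNorm f 2 κ ^ 2 = ∫⁻ a, ‖f a‖ₑ ^ 2 ∂κ := by
  have := eLpNorm_nnreal_pow_eq_lintegral (f := f) (μ := κ) (p := 2) two_ne_zero
  simpa using! this

theorem mixedNorm_two_sq_le {n : ℕ} {u : ℝ → Esp n → ℂ} {B : ℝ → ℝ≥0∞}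
    (hu : ∀ t x, ‖u t x‖ₑ ≤ B t) : mixedNorm n 2 ⊤ u ^ 2 ≤ ∫⁻ t, B t ^ 2 := by
  rw [mixedNorm, eLpNorm_two_sq]
  refine lintegral_mono fun t => ?_
  gcongr
  rw [Real.enorm_of_nonneg ENNReal.toReal_nonneg]
  refine ENNReal.ofReal_toReal_le.trans ?_
  rw [eLpNorm_exponent_top]
  exact eLpNormEssSup_le_of_ae_enorm_bound (ae_of_all _ (hu t))

theorem ENNReal.add_sq_le_two_mul (a b : ℝ≥0∞) : (a + b) ^ 2 ≤ 2 * a ^ 2 + 2 * b ^ 2 := by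
  have := ENNReal.rpow_add_le_mul_rpow_add_rpow a b (p := 2) (by norm_num)
  rw [← mul_add]
  norm_num at this
  exact_mod_cast this

theorem enorm_halfAmplitude_sq_le {n : ℕ} {χ : Esp n → ℝ} {F0 F1 : Esp n → ℂ} {s : ℝ}
    (hs : |s| = 1) {ξ : Esp n} (hχ : 0 ≤ χ ξ ∧ χ ξ ≤ 1) (hF1 : F1 ξ ≠ 0 → 1 / 2 ≤ ‖ξ‖) :
    ‖halfAmplitude χ F0 F1 s ξ‖ₑ ^ 2 ≤
      ENNReal.ofReal (χ ξ) * (2 * ‖F0 ξ‖ₑ ^ 2 + 2 * ‖F1 ξ‖ₑ ^ 2) := by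
  have h : ‖halfAmplitude χ F0 F1 s ξ‖ₑ ≤ ENNReal.ofReal (χ ξ) * (‖F0 ξ‖ₑ + ‖F1 ξ‖ₑ) := by
    rw [← ofReal_norm, ← ofReal_norm, ← ofReal_norm,
      ← ENNReal.ofReal_add (norm_nonneg _) (norm_nonneg _), ← ENNReal.ofReal_mul hχ.1]
    refine ENNReal.ofReal_le_ofReal ((norm_halfAmplitude_le hs hF1).trans_eq ?_)
    rw [abs_of_nonneg hχ.1]
  have h1 : ENNReal.ofReal (χ ξ) ≤ 1 := ENNReal.ofReal_le_one.2 hχ.2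
  calc ‖halfAmplitude χ F0 F1 s ξ‖ₑ ^ 2
      ≤ (ENNReal.ofReal (χ ξ) * (‖F0 ξ‖ₑ + ‖F1 ξ‖ₑ)) ^ 2 := by gcongr
    _ = ENNReal.ofReal (χ ξ) ^ 2 * (‖F0 ξ‖ₑ + ‖F1 ξ‖ₑ) ^ 2 := mul_pow _ _ _
    _ ≤ _ := by
      gcongr
      · exact pow_le_of_le_one zero_le h1 two_ne_zero
      · exact ENNReal.add_sq_le_two_mul _ _

theorem mixedNorm_wavePiece_sq_le {n : ℕ} {S : Set (Esp n)} (hS : MeasurableSet S)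
    (ν : Measure (Esp n)) [IsFiniteMeasure ν] (hν : volume.restrict S ≤ ν)
    {M : ℝ → ℝ} (hM : Integrable M) (hM0 : 0 < ∫ t, M t)
    (hK : ∀ t x, ‖∫ ξ, wavePhase t x ξ ∂ν‖ ≤ M t)
    {χ : Esp n → ℝ} (hχ : Continuous χ) (hχ1 : ∀ ξ, 0 ≤ χ ξ ∧ χ ξ ≤ 1) {f0 f1 : Esp n → ℂ}
    (h0 : Integrable (𝓕 f0)) (h1 : Integrable (𝓕 f1))
    (h02 : MemLp (𝓕 f0) 2) (h12 : MemLp (𝓕 f1) 2)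
    (hF1 : ∀ ξ, 𝓕 f1 ξ ≠ 0 → 1 / 2 ≤ ‖ξ‖)
    (hsupp : Function.support χ ∩ (Function.support (𝓕 f0) ∪ Function.support (𝓕 f1)) ⊆ S) :
    mixedNorm n 2 ⊤ (wavePiece n χ f0 f1) ^ 2 ≤ ENNReal.ofReal (∫ t, M t) *
      ∫⁻ ξ, ENNReal.ofReal (χ ξ) * (8 * ‖𝓕 f0 ξ‖ₑ ^ 2 + 8 * ‖𝓕 f1 ξ‖ₑ ^ 2) := by
  have h_int : ∀ s : ℝ, |s| = 1 → Integrable (halfAmplitude χ (𝓕 f0) (𝓕 f1) s) := fun s hs =>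
    integrable_halfAmplitude hχ hχ1 h0 h1 hs hF1
  have hsq : ∀ s : ℝ, |s| = 1 → Integrable fun ξ => ‖halfAmplitude χ (𝓕 f0) (𝓕 f1) s ξ‖ ^ 2 := by
    intro s hs
    refine (memLp_two_iff_integrable_sq_norm (h_int s hs).1).1 ?_
    refine (h02.norm.add h12.norm).mono' (h_int s hs).1 (ae_of_all _ fun ξ => ?_)
    refine (norm_halfAmplitude_le hs (hF1 ξ)).trans (mul_le_of_le_one_left (by positivity) ?_)
    rw [abs_of_nonneg (hχ1 ξ).1]
    exact (hχ1 ξ).2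
  have hhalf : ∀ s : ℝ, |s| = 1 → ∫⁻ t, halfSup (halfAmplitude χ (𝓕 f0) (𝓕 f1) s) t ^ 2 ≤
      ENNReal.ofReal (∫ t, M t) *
        ∫⁻ ξ, ENNReal.ofReal (χ ξ) * (2 * ‖𝓕 f0 ξ‖ₑ ^ 2 + 2 * ‖𝓕 f1 ξ‖ₑ ^ 2) := by
    intro s hs
    refine (lintegral_halfSup_sq_le hS ν hν hM hM0 hK (h_int s hs) (hsq s hs)
      ((support_halfAmplitude χ _ _ s).trans hsupp)).trans ?_
    gcongr with ξ
    exact enorm_halfAmplitude_sq_le hs (hχ1 ξ) (hF1 ξ)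
  have hp1 : |(1 : ℝ)| = 1 := abs_one
  have hm1 : |(-1 : ℝ)| = 1 := by simp
  have hpm := measurable_halfSup (h_int 1 hp1)
  have hmm : Measurable fun t => halfSup (halfAmplitude χ (𝓕 f0) (𝓕 f1) (-1)) (-t) :=
    (measurable_halfSup (h_int (-1) hm1)).comp measurable_neg
  calc mixedNorm n 2 ⊤ (wavePiece n χ f0 f1) ^ 2
      ≤ ∫⁻ t, (halfSup (halfAmplitude χ (𝓕 f0) (𝓕 f1) 1) t +
          halfSup (halfAmplitude χ (𝓕 f0) (𝓕 f1) (-1)) (-t)) ^ 2 := by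
        refine mixedNorm_two_sq_le fun t x => ?_
        rw [wavePiece_eq_add (h_int 1 hp1) (h_int (-1) hm1)]
        exact (enorm_add_le _ _).trans (add_le_add (enorm_halfWave_le_halfSup (h_int 1 hp1) t x)
          (enorm_halfWave_le_halfSup (h_int (-1) hm1) (-t) x))
    _ ≤ ∫⁻ t, (2 * halfSup (halfAmplitude χ (𝓕 f0) (𝓕 f1) 1) t ^ 2 +
          2 * halfSup (halfAmplitude χ (𝓕 f0) (𝓕 f1) (-1)) (-t) ^ 2) :=
        lintegral_mono fun t => ENNReal.add_sq_le_two_mul _ _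
    _ = 2 * (∫⁻ t, halfSup (halfAmplitude χ (𝓕 f0) (𝓕 f1) 1) t ^ 2) +
          2 * ∫⁻ t, halfSup (halfAmplitude χ (𝓕 f0) (𝓕 f1) (-1)) t ^ 2 := by
        rw [lintegral_add_left ((hpm.pow_const 2).const_mul 2),
          lintegral_const_mul _ (hpm.pow_const 2),
          lintegral_const_mul _ (hmm.pow_const 2),
          lintegral_neg_eq_self
            (fun t => halfSup (halfAmplitude χ (𝓕 f0) (𝓕 f1) (-1)) t ^ 2)]
    _ ≤ 2 * (ENNReal.ofReal (∫ t, M t) *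
          ∫⁻ ξ, ENNReal.ofReal (χ ξ) * (2 * ‖𝓕 f0 ξ‖ₑ ^ 2 + 2 * ‖𝓕 f1 ξ‖ₑ ^ 2)) +
        2 * (ENNReal.ofReal (∫ t, M t) *
          ∫⁻ ξ, ENNReal.ofReal (χ ξ) * (2 * ‖𝓕 f0 ξ‖ₑ ^ 2 + 2 * ‖𝓕 f1 ξ‖ₑ ^ 2)) := by
        gcongr
        · exact hhalf 1 hp1
        · exact hhalf (-1) hm1
    _ = ENNReal.ofReal (∫ t, M t) *
          (4 * ∫⁻ ξ, ENNReal.ofReal (χ ξ) * (2 * ‖𝓕 f0 ξ‖ₑ ^ 2 + 2 * ‖𝓕 f1 ξ‖ₑ ^ 2)) := by ring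
    _ = _ := by
        rw [← lintegral_const_mul' _ _ (by norm_num)]
        congr 2
        funext ξ
        ring

theorem lintegral_enorm_sq_fourier_le {n : ℕ} {f : Esp n → ℂ} (h : Integrable (𝓕 f)) :
    ∫⁻ ξ, ‖𝓕 f ξ‖ₑ ^ 2 ≤ ENNReal.ofReal (eLpNorm f 2 volume).toReal ^ 2 := by
  by_cases hf : Integrable f
  · rw [ENNReal.ofReal_toReal (memLp_two_of_integrable_fourier hf h).2.ne, eLpNorm_two_sq,
      lintegral_enorm_sq_fourier hf h]
  · have : 𝓕 f = 0 := by
      funext ξ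
      rw [Real.fourier_eq]
      refine integral_undef ?_
      rwa [Real.fourierIntegral_convergent_iff]
    simp [this]

theorem klainerman_tataru_L2Linfty (n : ℕ) (hn : 4 ≤ n) (A : ℕ) :
    ∃ C : ℝ, 0 < C ∧
      ∀ (μ : ℝ), 0 < μ → μ ≤ 1 →
      ∀ (ι : Type) (_ : Countable ι) (center : ι → Esp n) (χ : ι → Esp n → ℝ),
        -- smooth localizers adapted to cubes of diameter `μ`
        (∀ c, ContDiff ℝ (⊤ : ℕ∞) (χ c)) →
        (∀ c ξ, 0 ≤ χ c ξ ∧ χ c ξ ≤ 1) →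
        (∀ c, Function.support (χ c) ⊆ Metric.ball (center c) μ) →
        -- partition of unity on the annulus
        (∀ ξ : Esp n, 1 / 2 ≤ ‖ξ‖ → ‖ξ‖ ≤ 2 → HasSum (fun c => χ c ξ) 1) →
        -- uniformly finite overlap
        (∀ ξ : Esp n, {c | χ c ξ ≠ 0}.Finite ∧ Nat.card {c | χ c ξ ≠ 0} ≤ A) →
      ∀ (f0 f1 : Esp n → ℂ),
        Integrable (𝓕 f0) → Integrable (𝓕 f1) →
        Function.support (𝓕 f0) ⊆ {ξ | 1 / 2 ≤ ‖ξ‖ ∧ ‖ξ‖ ≤ 2} →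
        Function.support (𝓕 f1) ⊆ {ξ | 1 / 2 ≤ ‖ξ‖ ∧ ‖ξ‖ ≤ 2} →
        (∑' c : ι, (mixedNorm n 2 ⊤ (wavePiece n (χ c) f0 f1)) ^ 2)
          ≤ (ENNReal.ofReal (C * μ ^ (((n : ℝ) - 2) / 2) *
              ((eLpNorm f0 2 volume).toReal + (eLpNorm f1 2 volume).toReal))) ^ 2 := by
  obtain ⟨k, rfl⟩ : ∃ k, n = k + 2 := ⟨n - 2, by omega⟩
  obtain ⟨C, hC, hball⟩ := exists_ball_majorant (m := k + 1) (by omega)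
  obtain ⟨K, hK, hdecay⟩ := exists_integral_decay k
  refine ⟨Real.sqrt (8 * (C * K)), by positivity, ?_⟩
  intro μ hμ hμ1 ι _ center χ hχsm hχ1 hχs hχsum _ f0 f1 h0 h1 hs0 hs1
  obtain ⟨hMi, hMv⟩ := hdecay C μ hC hμ
  have hpiece : ∀ c, mixedNorm (k + 2) 2 ⊤ (wavePiece (k + 2) (χ c) f0 f1) ^ 2 ≤
      ENNReal.ofReal (C * K * μ ^ k) * ∫⁻ ξ, ENNReal.ofReal (χ c ξ) *
        (8 * ‖𝓕 f0 ξ‖ₑ ^ 2 + 8 * ‖𝓕 f1 ξ‖ₑ ^ 2) := by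
    intro c
    obtain ⟨ν, hνf, hν, hνK⟩ := hball μ (center c) hμ hμ1
    have hS : MeasurableSet (ball (center c) μ ∩ {ξ | 1 / 2 ≤ ‖ξ‖ ∧ ‖ξ‖ ≤ 2}) := by
      refine measurableSet_ball.inter (MeasurableSet.inter ?_ ?_)
      · exact measurableSet_le measurable_const measurable_norm
      · exact measurableSet_le measurable_norm measurable_const
    rw [← hMv]
    exact mixedNorm_wavePiece_sq_le hS ν hν hMi (by rw [hMv]; positivity) hνK
      (hχsm c).continuous (hχ1 c) h0 h1 (memLp_two_fourier h0) (memLp_two_fourier h1)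
      (fun ξ hξ => (hs1 hξ).1) (Set.inter_subset_inter (hχs c) (Set.union_subset hs0 hs1))
  have hpartition : ∀ ξ, ∑' c, ENNReal.ofReal (χ c ξ) *
      (8 * ‖𝓕 f0 ξ‖ₑ ^ 2 + 8 * ‖𝓕 f1 ξ‖ₑ ^ 2) = 8 * ‖𝓕 f0 ξ‖ₑ ^ 2 + 8 * ‖𝓕 f1 ξ‖ₑ ^ 2 := by
    intro ξ
    by_cases hξ : 1 / 2 ≤ ‖ξ‖ ∧ ‖ξ‖ ≤ 2
    · have hsum := hχsum ξ hξ.1 hξ.2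
      rw [ENNReal.tsum_mul_right, ← ENNReal.ofReal_tsum_of_nonneg (fun c => (hχ1 c ξ).1)
        hsum.summable, hsum.tsum_eq, ENNReal.ofReal_one, one_mul]
    · have e0 : 𝓕 f0 ξ = 0 := by_contra fun h => hξ (hs0 h)
      have e1 : 𝓕 f1 ξ = 0 := by_contra fun h => hξ (hs1 h)
      simp [e0, e1]
  have hm0 : AEMeasurable fun ξ => 8 * ‖𝓕 f0 ξ‖ₑ ^ 2 := (h0.1.enorm.pow_const 2).const_mul 8
  have hm1 : AEMeasurable fun ξ => 8 * ‖𝓕 f1 ξ‖ₑ ^ 2 := (h1.1.enorm.pow_const 2).const_mul 8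
  have hm : ∀ c, AEMeasurable fun ξ => ENNReal.ofReal (χ c ξ) *
      (8 * ‖𝓕 f0 ξ‖ₑ ^ 2 + 8 * ‖𝓕 f1 ξ‖ₑ ^ 2) := fun c =>
    (hχsm c).continuous.measurable.ennreal_ofReal.aemeasurable.mul (hm0.add hm1)
  have hpow : (Real.sqrt (8 * (C * K)) * μ ^ ((((k + 2 : ℕ) : ℝ) - 2) / 2)) ^ 2 =
      8 * (C * K * μ ^ k) := by
    rw [mul_pow, Real.sq_sqrt (by positivity), ← Real.rpow_natCast _ 2, ← Real.rpow_mul hμ.le,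
      ← Real.rpow_natCast μ k]
    have : (((k + 2 : ℕ) : ℝ) - 2) / 2 * ((2 : ℕ) : ℝ) = k := by
      push_cast
      ring
    rw [this]
    ring
  set a := (eLpNorm f0 2 volume).toReal
  set b := (eLpNorm f1 2 volume).toReal
  have ha0 : 0 ≤ a := ENNReal.toReal_nonneg
  have hb0 : 0 ≤ b := ENNReal.toReal_nonneg
  calc ∑' c, mixedNorm (k + 2) 2 ⊤ (wavePiece (k + 2) (χ c) f0 f1) ^ 2
      ≤ ∑' c, ENNReal.ofReal (C * K * μ ^ k) * ∫⁻ ξ, ENNReal.ofReal (χ c ξ) *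
        (8 * ‖𝓕 f0 ξ‖ₑ ^ 2 + 8 * ‖𝓕 f1 ξ‖ₑ ^ 2) := ENNReal.tsum_le_tsum hpiece
    _ = ENNReal.ofReal (C * K * μ ^ k) *
        ((8 * ∫⁻ ξ, ‖𝓕 f0 ξ‖ₑ ^ 2) + 8 * ∫⁻ ξ, ‖𝓕 f1 ξ‖ₑ ^ 2) := by
      rw [ENNReal.tsum_mul_left, ← lintegral_tsum hm]
      simp_rw [hpartition]
      rw [lintegral_add_left' hm0, lintegral_const_mul' _ _ (by norm_num),
        lintegral_const_mul' _ _ (by norm_num)]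
    _ ≤ ENNReal.ofReal (C * K * μ ^ k) *
        (8 * ENNReal.ofReal a ^ 2 + 8 * ENNReal.ofReal b ^ 2) := by
      gcongr
      · exact lintegral_enorm_sq_fourier_le h0
      · exact lintegral_enorm_sq_fourier_le h1
    _ = ENNReal.ofReal (8 * (C * K * μ ^ k) * (a ^ 2 + b ^ 2)) := by
      rw [← mul_add, ← ENNReal.ofReal_pow ha0, ← ENNReal.ofReal_pow hb0,
        ← ENNReal.ofReal_add (by positivity) (by positivity),
        ENNReal.ofReal_mul (p := 8 * (C * K * μ ^ k)) (by positivity),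
        ENNReal.ofReal_mul (p := 8) (by norm_num), ENNReal.ofReal_ofNat]
      ring
    _ ≤ _ := by
      rw [← ENNReal.ofReal_pow (by positivity), mul_pow, hpow]
      gcongr
      nlinarith [mul_nonneg ha0 hb0]

end
end

section
/- Let $n\ge2$, $0<\mu\le1$, and $T\in\mathbb{R}$. There is a constant $C=C(n)$ such that: if $\phi:\mathbb{R}^n\to\mathbb{C}$ satisfies $|\phi(y)|\le\mu^n(1+\mu|y|)^{-2n}$ for all $y$, and $F:\mathbb{R}^n\to\mathbb{C}$ satisfies $|F(x)|\le\frac{1}{(1+|T|)^{\frac{n-1}{2}}}\cdot\frac{1}{(1+\big||x|-|T|\big|)^{\frac12}}$ for all $x$, then $\|\phi*F\|_{L^\infty(\mathbb{R}^n)}\le C\,\mu^{\frac12}\,(1+|T|)^{-\frac{n-1}{2}}$. -/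
/-!
STATEMENT 16: The key kernel (convolution) estimate.
Let `n ≥ 2`, `0 < μ ≤ 1`, `T ∈ ℝ`. There is `C = C(n)` such that: if
`|φ(y)| ≤ μⁿ (1+μ|y|)^{-2n}` and `|F(x)| ≤ (1+|T|)^{-(n-1)/2} (1+||x|-|T||)^{-1/2}`,
then `‖φ * F‖_{L^∞} ≤ C μ^{1/2} (1+|T|)^{-(n-1)/2}`.
-/

open MeasureTheory

open scoped ENNReal in
/-- Tonelli for a product weight, with the integral in one coordinate bounded uniformly. -/
lemma lintegral_prod_weight_mul_le {m : ℕ} (i : Fin (m + 1)) {w : ℝ → ℝ≥0∞} (hw : Measurable w)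
    {g : ℝ → (Fin m → ℝ) → ℝ≥0∞} (hg : Measurable (Function.uncurry g)) {K : ℝ≥0∞}
    (hK : ∀ v, ∫⁻ s, w s * g s v ≤ K) :
    ∫⁻ y : Fin (m + 1) → ℝ, (∏ j, w (y j)) * g (y i) (i.removeNth y) ≤
      K * ∫⁻ v : Fin m → ℝ, ∏ j, w (v j) := by
  have hP : Measurable fun v : Fin m → ℝ => ∏ j, w (v j) := by fun_prop
  have hg' : Measurable fun p : ℝ × (Fin m → ℝ) => g p.1 p.2 := hg
  have hmeas : Measurable fun p : ℝ × (Fin m → ℝ) =>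
      (w p.1 * ∏ j, w (p.2 j)) * g p.1 p.2 := by fun_prop
  calc ∫⁻ y : Fin (m + 1) → ℝ, (∏ j, w (y j)) * g (y i) (i.removeNth y)
      = ∫⁻ p : ℝ × (Fin m → ℝ), (w p.1 * ∏ j, w (p.2 j)) * g p.1 p.2 := by
        rw [(volume_preserving_piFinSuccAbove (fun _ : Fin (m + 1) => ℝ) i).lintegral_map_equiv]
        refine lintegral_congr fun y => ?_
        rw [Fin.prod_univ_succAbove _ i]
        rfl
    _ = ∫⁻ v : Fin m → ℝ, (∏ j, w (v j)) * ∫⁻ s, w s * g s v := by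
        rw [Measure.volume_eq_prod, lintegral_prod_symm' _ hmeas]
        refine lintegral_congr fun v => ?_
        rw [← lintegral_const_mul _ (by fun_prop : Measurable fun s => w s * g s v)]
        refine lintegral_congr fun s => ?_
        dsimp only
        ring
    _ ≤ ∫⁻ v : Fin m → ℝ, (∏ j, w (v j)) * K := by
        gcongr with v
        exact hK v
    _ = K * ∫⁻ v : Fin m → ℝ, ∏ j, w (v j) := by
        rw [lintegral_mul_const _ hP, mul_comm]

open scoped ENNReal in
lemma lintegral_prod_weight_le_pow (m : ℕ) {w : ℝ → ℝ≥0∞} (hw : Measurable w) :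
    ∫⁻ v : Fin m → ℝ, ∏ j, w (v j) ≤ (∫⁻ s, w s) ^ m := by
  induction m with
  | zero => simp [volume_pi]
  | succ m ih =>
    have h := lintegral_prod_weight_mul_le (m := m) 0 hw (g := fun _ _ => 1) (by fun_prop)
      (K := ∫⁻ s, w s) (fun v => by simp)
    simp only [mul_one] at h
    rw [pow_succ']
    exact h.trans (by gcongr)

lemma lintegral_cauchy_weight {μ : ℝ} (hμ : 0 < μ) :
    ∫⁻ s : ℝ, ENNReal.ofReal (μ * (1 + (μ * s) ^ 2)⁻¹) = ENNReal.ofReal Real.pi := by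
  rw [← ofReal_integral_eq_lintegral_ofReal
    ((integrable_inv_one_add_sq.comp_mul_left' hμ.ne').const_mul μ)
    (ae_of_all _ fun s => by positivity), integral_const_mul,
    Measure.integral_comp_mul_left (fun x : ℝ => (1 + x ^ 2)⁻¹), integral_univ_inv_one_add_sq,
    abs_of_pos (inv_pos.2 hμ), smul_eq_mul, mul_inv_cancel_left₀ hμ.ne']

lemma lintegral_indicator_inv_sqrt_le {R : ℝ} (hR : 0 ≤ R) :
    ∫⁻ s : ℝ, ENNReal.ofReal
      ((Set.Icc 0 R).indicator (fun s => (1 + |s|) ^ (-((1 : ℝ) / 2))) s) ≤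
      ENNReal.ofReal (2 * √R) := by
  have hcont : Continuous fun s : ℝ => (1 + |s|) ^ (-((1 : ℝ) / 2)) :=
    Continuous.rpow_const (by fun_prop) fun s => Or.inl (by positivity)
  rw [← ofReal_integral_eq_lintegral_ofReal
    ((integrable_indicator_iff measurableSet_Icc).2 hcont.integrableOn_Icc)
    (ae_of_all _ fun s => Set.indicator_nonneg (fun _ _ => by positivity) s)]
  refine ENNReal.ofReal_le_ofReal ?_
  rw [integral_indicator measurableSet_Icc, integral_Icc_eq_integral_Ioc,
    ← intervalIntegral.integral_of_le hR]
  have h : ∫ s in (0 : ℝ)..R, (1 + |s|) ^ (-((1 : ℝ) / 2)) =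
      ∫ s in (0 : ℝ)..R, (1 + s) ^ (-((1 : ℝ) / 2)) := by
    refine intervalIntegral.integral_congr fun s hs => ?_
    rw [Set.uIcc_of_le hR] at hs
    simp only [abs_of_nonneg hs.1]
  rw [h, intervalIntegral.integral_comp_add_left (fun s : ℝ => s ^ (-((1 : ℝ) / 2))),
    integral_rpow (Or.inl (by norm_num))]
  norm_num only [add_zero]
  rw [← Real.sqrt_eq_rpow]
  have : √(1 + R) ≤ 1 + √R := by
    rw [Real.sqrt_le_left (by positivity)]
    nlinarith [Real.sq_sqrt hR, Real.sqrt_nonneg R]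
  linarith

lemma lintegral_cauchy_weight_mul_shift_le {μ : ℝ} (hμ : 0 < μ) (b : ℝ) :
    ∫⁻ s : ℝ, ENNReal.ofReal (μ * (1 + (μ * s) ^ 2)⁻¹) *
      ENNReal.ofReal ((1 + |s - b|) ^ (-((1 : ℝ) / 2))) ≤
      ENNReal.ofReal ((Real.pi + 4) * √μ) := by
  set f : ℝ → ℝ := (Set.Icc 0 μ⁻¹).indicator (fun s => (1 + |s|) ^ (-((1 : ℝ) / 2))) with hf
  have hf0 : ∀ s, 0 ≤ f s := fun s => Set.indicator_nonneg (fun _ _ => by positivity) s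
  have hfm : Measurable f := Measurable.indicator (by fun_prop) measurableSet_Icc
  have hμ' := Real.sqrt_pos.2 hμ
  have key : ∀ s, (μ * (1 + (μ * s) ^ 2)⁻¹) * (1 + |s - b|) ^ (-((1 : ℝ) / 2)) ≤
      √μ * (μ * (1 + (μ * s) ^ 2)⁻¹) + μ * (f (s - b) + f (b - s)) := by
    intro s
    have hw1 : (1 + (μ * s) ^ 2)⁻¹ ≤ 1 := inv_le_one_of_one_le₀ (by nlinarith [sq_nonneg (μ * s)])
    have hw0 : 0 ≤ μ * (1 + (μ * s) ^ 2)⁻¹ := by positivity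
    have hr0 : 0 ≤ (1 + |s - b|) ^ (-((1 : ℝ) / 2)) := by positivity
    rcases le_total |s - b| μ⁻¹ with h | h
    · have hr : (1 + |s - b|) ^ (-((1 : ℝ) / 2)) ≤ f (s - b) + f (b - s) := by
        rcases le_total 0 (s - b) with h0 | h0
        · have : f (s - b) = (1 + |s - b|) ^ (-((1 : ℝ) / 2)) :=
            Set.indicator_of_mem (Set.mem_Icc.2 ⟨h0, (le_abs_self _).trans h⟩) _
          linarith [hf0 (b - s)]
        · rw [abs_sub_comm] at h ⊢
          have : f (b - s) = (1 + |b - s|) ^ (-((1 : ℝ) / 2)) :=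
            Set.indicator_of_mem (Set.mem_Icc.2 ⟨by linarith, (le_abs_self _).trans h⟩) _
          linarith [hf0 (s - b)]
      have h1 : μ * (1 + (μ * s) ^ 2)⁻¹ ≤ μ := mul_le_of_le_one_right hμ.le hw1
      calc _ ≤ μ * (f (s - b) + f (b - s)) := mul_le_mul h1 hr hr0 hμ.le
        _ ≤ _ := le_add_of_nonneg_left (by positivity)
    · have hr : (1 + |s - b|) ^ (-((1 : ℝ) / 2)) ≤ √μ := by
        calc _ ≤ (μ⁻¹) ^ (-((1 : ℝ) / 2)) :=
              Real.rpow_le_rpow_of_nonpos (by positivity) (by linarith) (by norm_num)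
          _ = √μ := by
              rw [Real.inv_rpow hμ.le, Real.rpow_neg hμ.le, inv_inv, Real.sqrt_eq_rpow]
      calc _ ≤ (μ * (1 + (μ * s) ^ 2)⁻¹) * √μ := by gcongr
        _ ≤ _ := by
          have := mul_nonneg hμ.le (add_nonneg (hf0 (s - b)) (hf0 (b - s)))
          linarith
  have hI := lintegral_indicator_inv_sqrt_le (inv_pos.2 hμ).le
  rw [← hf] at hI
  calc _ ≤ ∫⁻ s : ℝ, (ENNReal.ofReal √μ * ENNReal.ofReal (μ * (1 + (μ * s) ^ 2)⁻¹) +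
        ENNReal.ofReal μ * (ENNReal.ofReal (f (s - b)) + ENNReal.ofReal (f (b - s)))) := by
        refine lintegral_mono fun s => ?_
        have hw0 : 0 ≤ μ * (1 + (μ * s) ^ 2)⁻¹ := by positivity
        rw [← ENNReal.ofReal_mul hw0, ← ENNReal.ofReal_mul hμ'.le,
          ← ENNReal.ofReal_add (hf0 _) (hf0 _), ← ENNReal.ofReal_mul hμ.le,
          ← ENNReal.ofReal_add (mul_nonneg hμ'.le hw0)
            (mul_nonneg hμ.le (add_nonneg (hf0 _) (hf0 _)))]
        exact ENNReal.ofReal_le_ofReal (key s)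
    _ = ENNReal.ofReal √μ * ENNReal.ofReal Real.pi + ENNReal.ofReal μ *
        ((∫⁻ s, ENNReal.ofReal (f s)) + ∫⁻ s, ENNReal.ofReal (f s)) := by
        rw [lintegral_add_left (by fun_prop), lintegral_const_mul _ (by fun_prop),
          lintegral_cauchy_weight hμ, lintegral_const_mul _ (by fun_prop),
          lintegral_add_left (by fun_prop),
          lintegral_sub_right_eq_self (fun s => ENNReal.ofReal (f s)),
          lintegral_sub_left_eq_self (fun s => ENNReal.ofReal (f s))]
    _ ≤ ENNReal.ofReal √μ * ENNReal.ofReal Real.pi + ENNReal.ofReal μ *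
        (ENNReal.ofReal (2 * √μ⁻¹) + ENNReal.ofReal (2 * √μ⁻¹)) := by gcongr
    _ = ENNReal.ofReal ((Real.pi + 4) * √μ) := by
        rw [← ENNReal.ofReal_add (by positivity) (by positivity), ← ENNReal.ofReal_mul hμ'.le,
          ← ENNReal.ofReal_mul hμ.le, ← ENNReal.ofReal_add (by positivity) (by positivity)]
        congr 1
        rw [Real.sqrt_inv]
        field_simp
        rw [Real.sq_sqrt hμ.le]
        ring

lemma lintegral_cauchy_weight_mul_abs_le {μ : ℝ} (hμ : 0 < μ) (a τ : ℝ) :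
    ∫⁻ s : ℝ, ENNReal.ofReal (μ * (1 + (μ * s) ^ 2)⁻¹) *
      ENNReal.ofReal ((1 + |(|a - s| - τ)|) ^ (-((1 : ℝ) / 2))) ≤
      ENNReal.ofReal (2 * (Real.pi + 4) * √μ) := by
  calc _ ≤ ∫⁻ s : ℝ, (ENNReal.ofReal (μ * (1 + (μ * s) ^ 2)⁻¹) *
          ENNReal.ofReal ((1 + |s - (a - τ)|) ^ (-((1 : ℝ) / 2))) +
        ENNReal.ofReal (μ * (1 + (μ * s) ^ 2)⁻¹) *
          ENNReal.ofReal ((1 + |s - (a + τ)|) ^ (-((1 : ℝ) / 2)))) := by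
        refine lintegral_mono fun s => ?_
        dsimp only
        rw [← mul_add]
        gcongr
        rcases abs_choice (a - s) with h | h
        · rw [h, abs_sub_comm s, show a - τ - s = a - s - τ by ring]
          exact le_self_add
        · rw [h, show -(a - s) - τ = s - (a + τ) by ring]
          exact le_add_self
    _ = _ := lintegral_add_left (by fun_prop) _
    _ ≤ ENNReal.ofReal ((Real.pi + 4) * √μ) + ENNReal.ofReal ((Real.pi + 4) * √μ) :=
        add_le_add (lintegral_cauchy_weight_mul_shift_le hμ _)
          (lintegral_cauchy_weight_mul_shift_le hμ _)
    _ = _ := by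
        rw [← ENNReal.ofReal_add (by positivity) (by positivity)]
        congr 1
        ring

/-- Near the sphere of radius `T`, solving `‖z‖ = T` for a dominant coordinate `z i` gives
`|z i| = √(T² - ∑_{j ≠ i} z_j²)`, and the distance to this root is controlled by `|‖z‖ - T|`. -/
lemma exists_abs_sub_sqrt_le {m : ℕ} (z : EuclideanSpace ℝ (Fin (m + 1))) {T : ℝ} (hT : 0 ≤ T) :
    ∃ i, |(|z i| - √(T ^ 2 - ∑ j, (i.removeNth (z : Fin (m + 1) → ℝ) j) ^ 2))| ≤
      2 * (m + 1) * |‖z‖ - T| := by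
  obtain ⟨i, -, hi⟩ := Finset.exists_max_image Finset.univ (fun i => |z i|) ⟨0, Finset.mem_univ _⟩
  refine ⟨i, ?_⟩
  have hsum : ‖z‖ ^ 2 = |z i| ^ 2 + ∑ j, (i.removeNth (z : Fin (m + 1) → ℝ) j) ^ 2 := by
    rw [EuclideanSpace.norm_sq_eq, Fin.sum_univ_succAbove _ i]
    simp [Fin.removeNth]
  have hle : ‖z‖ ≤ (m + 1) * |z i| := by
    refine abs_le_of_sq_le_sq' ?_ (by positivity) |>.2
    have : ‖z‖ ^ 2 ≤ ∑ _j : Fin (m + 1), |z i| ^ 2 := by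
      rw [EuclideanSpace.norm_sq_eq]
      refine Finset.sum_le_sum fun j hj => ?_
      rw [Real.norm_eq_abs]
      exact pow_le_pow_left₀ (abs_nonneg _) (hi j hj) 2
    rw [Finset.sum_const, Finset.card_univ, Fintype.card_fin, nsmul_eq_mul] at this
    push_cast at this
    have hm : (0 : ℝ) ≤ m := m.cast_nonneg
    nlinarith [mul_nonneg (mul_nonneg hm (by positivity : (0 : ℝ) ≤ m + 1)) (sq_nonneg |z i|)]
  set S := ∑ j, (i.removeNth (z : Fin (m + 1) → ℝ) j) ^ 2 with hS
  have hS0 : 0 ≤ S := Finset.sum_nonneg fun j _ => sq_nonneg _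
  set u := |z i| with hu
  have hu0 : 0 ≤ u := abs_nonneg _
  set N := ‖z‖ with hN
  have hN0 : 0 ≤ N := norm_nonneg _
  set M : ℝ := m + 1 with hM
  have hM1 : 1 ≤ M := by simp [hM]
  have huN : u ≤ N := abs_le_of_sq_le_sq' (by linarith) hN0 |>.2
  rcases le_total S (T ^ 2) with h | h
  · set t := √(T ^ 2 - S) with ht
    have ht0 : 0 ≤ t := Real.sqrt_nonneg _
    have htsq : t ^ 2 = T ^ 2 - S := Real.sq_sqrt (by linarith)
    have hTt : T ≤ t + N := by
      refine abs_le_of_sq_le_sq' ?_ (by positivity) |>.2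
      nlinarith [mul_nonneg ht0 hN0, sq_nonneg u]
    have hfac : |u - t| * (u + t) = |N - T| * (N + T) := by
      rw [← abs_of_nonneg (add_nonneg hu0 ht0), ← abs_of_nonneg (add_nonneg hN0 hT), ← abs_mul,
        ← abs_mul]
      congr 1
      nlinarith
    rcases (add_nonneg hu0 ht0).eq_or_lt with h0 | h0
    · have hu' : u = 0 := by linarith
      have ht' : t = 0 := by linarith
      rw [hu', ht']
      simp only [sub_zero, abs_zero]
      positivity
    · refine le_of_mul_le_mul_right ?_ h0
      rw [hfac]
      have : N + T ≤ 2 * M * (u + t) := by nlinarith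
      calc _ ≤ |N - T| * (2 * M * (u + t)) := by gcongr
        _ = _ := by ring
  · rw [Real.sqrt_eq_zero_of_nonpos (by linarith), sub_zero, abs_of_nonneg hu0]
    have hTN : T ≤ N := abs_le_of_sq_le_sq' (by nlinarith) hN0 |>.2
    rw [abs_of_nonneg (by linarith)]
    rcases hu0.eq_or_lt with h0 | h0
    · rw [← h0]
      have : 0 ≤ N - T := by linarith
      positivity
    · refine le_of_mul_le_mul_right ?_ h0
      calc u * u ≤ (N - T) * (N + T) := by nlinarith
        _ ≤ (N - T) * (2 * M * u) := by
          gcongr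
          linarith
        _ = _ := by ring

lemma decay_le_prod {n : ℕ} {μ : ℝ} (hμ : 0 < μ) (y : EuclideanSpace ℝ (Fin n)) :
    μ ^ n * (1 + μ * ‖y‖) ^ (-(2 * (n : ℝ))) ≤ ∏ j, (μ * (1 + (μ * y j) ^ 2)⁻¹) := by
  have h0 : 0 < 1 + μ * ‖y‖ := by positivity
  rw [Finset.prod_mul_distrib, Finset.prod_const, Finset.card_univ, Fintype.card_fin,
    Real.rpow_neg h0.le, mul_comm (2 : ℝ), Real.rpow_mul h0.le, Real.rpow_natCast,
    Real.rpow_ofNat, ← pow_mul, mul_comm n, pow_mul, ← inv_pow]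
  gcongr
  calc _ = ∏ _j : Fin n, ((1 + μ * ‖y‖) ^ 2)⁻¹ := by simp
    _ ≤ _ := by
      refine Finset.prod_le_prod (fun _ _ => by positivity) fun j _ => ?_
      gcongr
      have h1 : |y j| ≤ ‖y‖ := by simpa using PiLp.norm_apply_le y j
      have h2 : (μ * y j) ^ 2 ≤ (μ * ‖y‖) ^ 2 := by
        rw [sq_le_sq, abs_mul, abs_mul, abs_norm]
        gcongr
      have h3 : 0 ≤ μ * ‖y‖ := by positivity
      nlinarith

lemma shell_decay_le_sum {m : ℕ} (z : EuclideanSpace ℝ (Fin (m + 1))) {T : ℝ} (hT : 0 ≤ T) :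
    (1 + |‖z‖ - T|) ^ (-((1 : ℝ) / 2)) ≤ √(2 * (m + 1)) *
      ∑ i, (1 + |(|z i| - √(T ^ 2 - ∑ j, (i.removeNth (z : Fin (m + 1) → ℝ) j) ^ 2))|) ^
        (-((1 : ℝ) / 2)) := by
  obtain ⟨i, hi⟩ := exists_abs_sub_sqrt_le z hT
  refine le_trans ?_ (mul_le_mul_of_nonneg_left
    (Finset.single_le_sum (fun i _ => by positivity) (Finset.mem_univ i)) (by positivity))
  set d := |(|z i| - √(T ^ 2 - ∑ j, (i.removeNth (z : Fin (m + 1) → ℝ) j) ^ 2))|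
  have hd : 0 ≤ d := abs_nonneg _
  set M : ℝ := 2 * (m + 1) with hM
  have hM1 : 1 ≤ M := by
    have : (0 : ℝ) ≤ m := m.cast_nonneg
    linarith
  have hM0 : 0 ≤ M := by linarith
  calc (1 + |‖z‖ - T|) ^ (-((1 : ℝ) / 2)) ≤ (M⁻¹ * (1 + d)) ^ (-((1 : ℝ) / 2)) := by
        refine Real.rpow_le_rpow_of_nonpos (by positivity) ?_ (by norm_num)
        rw [inv_mul_le_iff₀ (by linarith)]
        linarith
    _ = _ := by
        rw [Real.mul_rpow (by positivity) (by positivity), Real.inv_rpow hM0,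
          Real.rpow_neg hM0, inv_inv, Real.sqrt_eq_rpow]

theorem kernel_convolution_estimate (n : ℕ) (hn : 2 ≤ n) :
    ∃ C : ℝ, 0 < C ∧
      ∀ (μ T : ℝ), 0 < μ → μ ≤ 1 →
      ∀ (φ F : EuclideanSpace ℝ (Fin n) → ℂ),
        Measurable φ → Measurable F →
        (∀ y, ‖φ y‖ ≤ μ ^ n * (1 + μ * ‖y‖) ^ (-(2 * (n : ℝ)))) →
        (∀ x, ‖F x‖ ≤
          (1 + |T|) ^ (-(((n : ℝ) - 1) / 2)) * (1 + |‖x‖ - abs T|) ^ (-((1 : ℝ) / 2))) →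
        ∀ x, ‖∫ y, φ y * F (x - y)‖ ≤
          C * Real.sqrt μ * (1 + |T|) ^ (-(((n : ℝ) - 1) / 2)) := by
  obtain ⟨m, rfl⟩ : ∃ m, n = m + 1 := ⟨n - 1, by omega⟩
  refine ⟨√(2 * (m + 1)) * ((m + 1) * (2 * (Real.pi + 4) * Real.pi ^ m)), by positivity, ?_⟩
  intro μ T hμ _ φ F _ _ hφ hF x
  set B : ℝ := (1 + |T|) ^ (-((((m + 1 : ℕ) : ℝ) - 1) / 2)) with hB
  have hB0 : 0 ≤ B := by positivity
  set D : ℝ := √(2 * (m + 1)) with hD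
  have hD0 : 0 ≤ D := Real.sqrt_nonneg _
  let w : ℝ → ENNReal := fun s => ENNReal.ofReal (μ * (1 + (μ * s) ^ 2)⁻¹)
  have hw : Measurable w := by fun_prop
  let g : Fin (m + 1) → ℝ → (Fin m → ℝ) → ENNReal := fun i s v =>
    ENNReal.ofReal ((1 + |(|x i - s| - √(|T| ^ 2 - ∑ j, (x (i.succAbove j) - v j) ^ 2))|) ^
      (-((1 : ℝ) / 2)))
  have hg : ∀ i, Measurable (Function.uncurry (g i)) := fun i => by
    simp only [g, Function.uncurry_def]
    fun_prop
  let G : (Fin (m + 1) → ℝ) → ENNReal := fun y =>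
    ENNReal.ofReal (B * D) * ∑ i, (∏ j, w (y j)) * g i (y i) (i.removeNth y)
  have hpt : ∀ y : EuclideanSpace ℝ (Fin (m + 1)), ‖φ y * F (x - y)‖ₑ ≤ G (WithLp.ofLp y) := by
    intro y
    have h1 := (hφ y).trans (decay_le_prod hμ y)
    have h2 := (hF (x - y)).trans
      (mul_le_mul_of_nonneg_left (shell_decay_le_sum (x - y) (abs_nonneg T)) hB0)
    have h3 := mul_le_mul h1 h2 (norm_nonneg _) (Finset.prod_nonneg fun _ _ => by positivity)
    rw [← norm_mul] at h3
    rw [← ofReal_norm]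
    refine (ENNReal.ofReal_le_ofReal h3).trans_eq ?_
    simp only [G, w, g]
    rw [← Finset.mul_sum, ENNReal.ofReal_mul (Finset.prod_nonneg fun _ _ => by positivity),
      ENNReal.ofReal_prod_of_nonneg (fun _ _ => by positivity), ← mul_assoc B,
      ENNReal.ofReal_mul (mul_nonneg hB0 hD0),
      ENNReal.ofReal_sum_of_nonneg (fun _ _ => by positivity)]
    simp only [Fin.removeNth, PiLp.sub_apply]
    ring
  have hgm : ∀ i, Measurable fun y : Fin (m + 1) → ℝ => g i (y i) (i.removeNth y) := fun i =>
    (hg i).comp (f := fun y : Fin (m + 1) → ℝ => (y i, i.removeNth y)) (by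
      unfold Fin.removeNth
      fun_prop)
  have hterm : ∀ i, ∫⁻ y : Fin (m + 1) → ℝ, (∏ j, w (y j)) * g i (y i) (i.removeNth y) ≤
      ENNReal.ofReal (2 * (Real.pi + 4) * √μ * Real.pi ^ m) := fun i => by
    refine (lintegral_prod_weight_mul_le i hw (hg i)
      fun v => lintegral_cauchy_weight_mul_abs_le hμ _ _).trans ?_
    rw [ENNReal.ofReal_mul (by positivity : 0 ≤ 2 * (Real.pi + 4) * √μ),
      ENNReal.ofReal_pow Real.pi_pos.le,
      ← lintegral_cauchy_weight hμ]
    gcongr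
    exact lintegral_prod_weight_le_pow m hw
  have hmain : ‖∫ y, φ y * F (x - y)‖ₑ ≤
      ENNReal.ofReal (D * ((m + 1) * (2 * (Real.pi + 4) * Real.pi ^ m)) * √μ * B) :=
    calc _ ≤ ∫⁻ y, ‖φ y * F (x - y)‖ₑ := enorm_integral_le_lintegral_enorm _
      _ ≤ ∫⁻ y : EuclideanSpace ℝ (Fin (m + 1)), G (WithLp.ofLp y) := lintegral_mono hpt
      _ = ∫⁻ y, G y :=
        ((EuclideanSpace.volume_preserving_symm_measurableEquiv_toLp
          (Fin (m + 1))).lintegral_map_equiv G _).symm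
      _ = ENNReal.ofReal (B * D) *
          ∑ i, ∫⁻ y : Fin (m + 1) → ℝ, (∏ j, w (y j)) * g i (y i) (i.removeNth y) := by
        have hmeas : ∀ i ∈ Finset.univ, Measurable fun y : Fin (m + 1) → ℝ =>
            (∏ j, w (y j)) * g i (y i) (i.removeNth y) := fun i _ =>
          Measurable.mul (by fun_prop) (hgm i)
        rw [← lintegral_finsetSum _ hmeas,
          ← lintegral_const_mul _ (Finset.measurable_fun_sum _ hmeas)]
      _ ≤ ENNReal.ofReal (B * D) *
          ∑ _i : Fin (m + 1), ENNReal.ofReal (2 * (Real.pi + 4) * √μ * Real.pi ^ m) := by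
        gcongr with i
        exact hterm i
      _ = _ := by
        rw [← ENNReal.ofReal_sum_of_nonneg (fun _ _ => by positivity),
          ← ENNReal.ofReal_mul (by positivity), Finset.sum_const, Finset.card_univ,
          Fintype.card_fin, nsmul_eq_mul]
        congr 1
        push_cast
        ring
  rw [← ofReal_norm] at hmain
  exact (ENNReal.ofReal_le_ofReal_iff (by positivity)).1 hmain
end
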